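/- arXiv:2506.16271 — 2 statements merged into one kernel-verified Lean document; each statement's English description precedes it below -/
import Mathlib

section
/- Let q ≥ 3 be a prime power, I an index set, η ∈ F_{q^2} with η^{q+1} = 1, and let 𝒫 and 𝒫' be good sets such that every triple (α,u,v) of 𝒫 and every triple (α',u',v') of 𝒫' satisfies α^{q+1} ≠ −1 and α'^{q+1} ≠ −1. If 𝒫 ≠ 𝒫', then Π_𝒫 ≠ Π_{𝒫'} (as sets of line-spreads of Σ_η). -/
open Projectivization Classical

noncomputable section

abbrev Pt (F : Type) [Field F] := Projectivization F (Fin 4 → F)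

variable (q : ℕ) (F : Type) [Field F]

/-- The line `t₁ = {(x₁, x₂, 0, 0)}` of `PG(3, q²)`. -/
def t1 : Set (Pt F) := {P | P.rep 2 = 0 ∧ P.rep 3 = 0}

/-- The line `t₂ = {(0, 0, x₃, x₄)}` of `PG(3, q²)`. -/
def t2 : Set (Pt F) := {P | P.rep 0 = 0 ∧ P.rep 1 = 0}

/-- The line `r_{U₁} = {(x₁, 0, x₃, 0)}` of `PG(3, q²)`. -/
def rU1 : Set (Pt F) := {P | P.rep 1 = 0 ∧ P.rep 3 = 0}

/-- The Baer subgeometry `Σ_α = {(x, y, α xᑫ, α yᑫ)}`. -/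
def SigmaSet (α : F) : Set (Pt F) :=
  {P | ∃ (x y : F) (h : ![x, y, α * x ^ q, α * y ^ q] ≠ 0),
    P = Projectivization.mk F ![x, y, α * x ^ q, α * y ^ q] h}

def tauFun (α : F) (v : Fin 4 → F) : Fin 4 → F :=
  ![(v 2) ^ q, (v 3) ^ q, α ^ (q + 1) * (v 0) ^ q, α ^ (q + 1) * (v 1) ^ q]

/-- The collineation `τ_α : (x₁,x₂,x₃,x₄) ↦ (x₃ᑫ, x₄ᑫ, α^{q+1} x₁ᑫ, α^{q+1} x₂ᑫ)`. -/
def tau (α : F) (P : Pt F) : Pt F :=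
  if h : tauFun q F α P.rep ≠ 0 then Projectivization.mk F _ h else P

/-- `s` is (the point set of) a line of `PG(3, q²)`. -/
def isLine (s : Set (Pt F)) : Prop :=
  ∃ W : Submodule F (Fin 4 → F), Module.finrank F W = 2 ∧
    s = {P : Pt F | P.submodule ≤ W}

/-- `s` is (the point set of) a plane of `PG(3, q²)`. -/
def isPlane (s : Set (Pt F)) : Prop :=
  ∃ W : Submodule F (Fin 4 → F), Module.finrank F W = 3 ∧
    s = {P : Pt F | P.submodule ≤ W}

/-- The set of points of the line (or point) spanned by `A` and `B`. -/
def lineThrough (A B : Pt F) : Set (Pt F) :=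
  {P : Pt F | P.submodule ≤ A.submodule ⊔ B.submodule}

/-- For `P = (a, b, 0, 0) ∈ t₁`, `rLine P` is the line through `(a,b,0,0)` and `(0,0,aᑫ,bᑫ)`. -/
def rLine (P : Pt F) : Set (Pt F) := lineThrough F P (tau q F 1 P)

/-- The Desarguesian line-spread `D_α = { r_P ∩ Σ_α : P ∈ t₁ }`. -/
def Dspread (α : F) : Set (Set (Pt F)) :=
  {s | ∃ P ∈ t1 F, s = rLine q F P ∩ SigmaSet q F α}

/-- `U = { u : u^{q+1} = 1 }`. -/
def Uset : Set F := {u : F | u ^ (q + 1) = 1}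

/-- The subfield `F_q` of `F_{q²}`, as a set. -/
def FqSet : Set F := {x : F | x ^ q = x}

/-- The norm image `N = { α^{q+1} : α ∈ I }`. -/
def normIm (I : Set F) : Set F := (fun α : F => α ^ (q + 1)) '' I

/-- `I` is an index set. -/
def IsIndexSet (I : Set F) : Prop :=
  (0 : F) ∉ I ∧
  Set.InjOn (fun α : F => α ^ (q + 1)) I ∧
  (∀ a ∈ normIm q F I, a ∈ FqSet q F) ∧
  (1 : F) ∉ normIm q F I ∧
  normIm q F I ∪ Inv.inv '' normIm q F I ∪ {1} = FqSet q F \ {0} ∧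
  (Even q → normIm q F I ∩ Inv.inv '' normIm q F I = ∅) ∧
  (Odd q → normIm q F I ∩ Inv.inv '' normIm q F I = {-1} ∧
    normIm q F I ∩ Neg.neg '' normIm q F I = ∅)

lemma vec4_ne_zero_fst (a b c d : F) (ha : a ≠ 0) : ![a, b, c, d] ≠ 0 := by
  intro h
  exact ha (by simpa using congrFun h 0)

/-- The point `P_{αu} = (1, 0, αu, 0)`. -/
def Ppt (α u : F) : Pt F :=
  Projectivization.mk F ![1, 0, α * u, 0] (vec4_ne_zero_fst F 1 0 (α * u) 0 one_ne_zero)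

/-- The plane `π_{αv} : X₄ = α v X₂`. -/
def planeSet (α v : F) : Set (Pt F) := {P | P.rep 3 = α * v * P.rep 1}

/-- The Baer subpencil `p(P_{αu}, π_{αv})`: the lines through `P_{αu}` contained in `π_{αv}`
meeting `Σ_α` in `q+1` points. -/
def pencil (α u v : F) : Set (Set (Pt F)) :=
  {ℓ | isLine F ℓ ∧ Ppt F α u ∈ ℓ ∧ ℓ ⊆ planeSet F α v ∧ (ℓ ∩ SigmaSet q F α).ncard = q + 1}

/-- `m` is a line of the Baer subgeometry `Σ_η`. -/
def IsLineOfSigma (η : F) (m : Set (Pt F)) : Prop :=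
  ∃ s : Set (Pt F), isLine F s ∧ m = s ∩ SigmaSet q F η ∧ m.ncard = q + 1

/-- `S` is a line-spread of `Σ_η`. -/
def IsSpreadOfSigma (η : F) (S : Set (Set (Pt F))) : Prop :=
  (∀ m ∈ S, IsLineOfSigma q F η m) ∧
  (∀ m ∈ S, ∀ m' ∈ S, m ≠ m' → m ∩ m' = ∅) ∧
  ⋃₀ S = SigmaSet q F η

/-- `Pl` is a parallelism of `Σ_η`. -/
def IsParallelismOfSigma (η : F) (Pl : Set (Set (Set (Pt F)))) : Prop :=
  (∀ S ∈ Pl, IsSpreadOfSigma q F η S) ∧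
  ∀ m : Set (Pt F), IsLineOfSigma q F η m → ∃! S, S ∈ Pl ∧ m ∈ S

/-- `R` is a regulus of `Σ_η`. -/
def IsRegulusOfSigma (η : F) (R : Set (Set (Pt F))) : Prop :=
  ∃ m1 m2 m3 : Set (Pt F),
    IsLineOfSigma q F η m1 ∧ IsLineOfSigma q F η m2 ∧ IsLineOfSigma q F η m3 ∧
    m1 ∩ m2 = ∅ ∧ m1 ∩ m3 = ∅ ∧ m2 ∩ m3 = ∅ ∧
    R = {m | IsLineOfSigma q F η m ∧
      (m ∩ m1).Nonempty ∧ (m ∩ m2).Nonempty ∧ (m ∩ m3).Nonempty}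

/-- `S_ℓ = { ⟨Q, τ_η(Q)⟩ ∩ Σ_η : Q ∈ ℓ }`. -/
def Sspread (η : F) (ℓ : Set (Pt F)) : Set (Set (Pt F)) :=
  {m | ∃ Q ∈ ℓ, m = lineThrough F Q (tau q F η Q) ∩ SigmaSet q F η}

/-- `R_ℓ = D_η ∩ S_ℓ`. -/
def Rreg (η : F) (ℓ : Set (Pt F)) : Set (Set (Pt F)) :=
  Dspread q F η ∩ Sspread q F η ℓ

/-- `R_ℓᵒ`: the set of lines of `Σ_η` meeting every line of `R_ℓ`. -/
def Ropp (η : F) (ℓ : Set (Pt F)) : Set (Set (Pt F)) :=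
  {m | IsLineOfSigma q F η m ∧ ∀ m' ∈ Rreg q F η ℓ, (m ∩ m').Nonempty}

/-- `G` is a good set (relative to the index set `I`). -/
def IsGoodSet (I : Set F) (G : Finset (F × F × F)) : Prop :=
  G.card = q + 1 ∧
  (∀ t ∈ G, t.1 ∈ I ∧ t.2.1 ∈ Uset q F ∧ t.2.2 ∈ Uset q F) ∧
  ∀ t ∈ G, ∀ t' ∈ G, t ≠ t' →
    t.2.1 * t'.2.2 - t'.2.1 * t.2.2 ≠ 0 ∧
    t.1 * t.2.1 * (t'.1 * t'.2.2) ^ q - (t.1 * t.2.2) ^ q * (t'.1 * t'.2.1) ≠ 0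

/-- `L_G = ⋃_{(α,u,v) ∈ G} ( p(P_{αu}, π_{αv}) \ {r_{U₁}} )`. -/
def Lset (G : Finset (F × F × F)) : Set (Set (Pt F)) :=
  ⋃ t ∈ G, (pencil q F t.1 t.2.1 t.2.2 \ {rU1 F})

/-- The putative parallelism `Π_G` associated with `G`. -/
def ParP (η : F) (G : Finset (F × F × F)) : Set (Set (Set (Pt F))) :=
  {S | ∃ ℓ ∈ Lset q F G, S = (Sspread q F η ℓ \ Rreg q F η ℓ) ∪ Ropp q F η ℓ}
    ∪ {Dspread q F η}

def gFun (b : F) (v : Fin 4 → F) : Fin 4 → F :=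
  ![v 0 + b * v 1, v 1, v 2 + b ^ q * v 3, v 3]

/-- The projectivity `g_b : (x₁,x₂,x₃,x₄) ↦ (x₁ + b x₂, x₂, x₃ + bᑫ x₄, x₄)`. -/
def gmap (b : F) (P : Pt F) : Pt F :=
  if h : gFun q F b P.rep ≠ 0 then Projectivization.mk F _ h else P

end

section conjugation

lemma exists_conj {q : ℕ} (hq : IsPrimePow q) {F : Type} [Field F] [Fintype F]
    (hF : Fintype.card F = q ^ 2) :
    ∃ c : F →+* F, (∀ x, c x = x ^ q) ∧ ∀ x, c (c x) = x := by
  obtain ⟨p, k, hp, hk, rfl⟩ := hq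
  have hp' := hp.nat_prime
  obtain ⟨r, hr⟩ := CharP.exists F
  obtain ⟨n, hrp, hn⟩ := FiniteField.card F r
  have hpr : p = r := by
    have h1 : p ∣ r ^ (n : ℕ) := by
      rw [← hn, hF]
      exact dvd_pow (dvd_pow_self p hk.ne') two_ne_zero
    exact (Nat.prime_dvd_prime_iff_eq hp' hrp).1 (hp'.dvd_of_dvd_pow h1)
  subst hpr
  have : Fact p.Prime := ⟨hp'⟩
  refine ⟨iterateFrobenius F p k, fun x => iterateFrobenius_def p k x, fun x => ?_⟩
  rw [iterateFrobenius_def, iterateFrobenius_def, ← pow_mul, ← sq, ← hF, FiniteField.pow_card]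

variable {q : ℕ} {F : Type} [Field F] {c : F →+* F}

lemma ncard_conj_eq_mul_le (hq : 2 ≤ q) (hc : ∀ x, c x = x ^ q) (u : F) :
    {x : F | c x = u * x}.ncard ≤ q := by
  have hdeg : (Polynomial.C u * Polynomial.X : Polynomial F).natDegree < q :=
    lt_of_le_of_lt ((Polynomial.natDegree_C_mul_le _ _).trans Polynomial.natDegree_X_le) hq
  have hd : (Polynomial.X ^ q - Polynomial.C u * Polynomial.X : Polynomial F).natDegree = q := by
    rw [Polynomial.natDegree_sub_eq_left_of_natDegree_lt] <;> simp [hdeg]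
  have h0 : (Polynomial.X ^ q - Polynomial.C u * Polynomial.X : Polynomial F) ≠ 0 := by
    intro h
    rw [h, Polynomial.natDegree_zero] at hd
    omega
  calc {x : F | c x = u * x}.ncard
      ≤ ((Polynomial.X ^ q - Polynomial.C u * Polynomial.X : Polynomial F).roots.toFinset
          : Set F).ncard := by
        refine Set.ncard_le_ncard (fun x hx => ?_) (Finset.finite_toSet _)
        have hx' : c x = u * x := hx
        simp [Polynomial.mem_roots h0, ← hc, hx']
    _ ≤ q := by
        rw [Set.ncard_coe_finset]
        exact (Multiset.toFinset_card_le _).trans ((Polynomial.card_roots' _).trans hd.le)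

variable [Fintype F]

lemma ncard_conj_eq_mul (hq : 2 ≤ q) (hF : Fintype.card F = q ^ 2) (hc : ∀ x, c x = x ^ q)
    (hcc : ∀ x, c (c x) = x) {u : F} (hu : c u * u = 1) :
    {x : F | c x = u * x}.ncard = q := by
  refine le_antisymm (ncard_conj_eq_mul_le hq hc u) ?_
  let f : F →+ F := c.toAddMonoidHom - AddMonoidHom.mulLeft u
  have hf : ∀ x, f x = c x - u * x := fun x => rfl
  have h1 : Nat.card f.range * Nat.card f.ker = q ^ 2 := by
    rw [← hF, ← Nat.card_eq_fintype_card, mul_comm, ← AddSubgroup.index_ker f,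
      AddSubgroup.card_mul_index]
  have hk : Nat.card f.ker = {x : F | c x = u * x}.ncard := by
    rw [← Nat.card_coe_set_eq]
    refine Nat.card_congr (Equiv.setCongr ?_)
    ext x
    simp [AddMonoidHom.mem_ker, hf, sub_eq_zero]
  have hr : Nat.card f.range ≤ q := by
    refine le_trans ?_ (ncard_conj_eq_mul_le hq hc (-c u))
    rw [← Nat.card_coe_set_eq]
    refine Nat.card_mono (Set.toFinite _) ?_
    rintro _ ⟨x, rfl⟩
    simp only [hf, Set.mem_ofPred_eq, map_sub, map_mul, hcc]
    linear_combination -x * hu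
  rw [hk] at h1
  by_contra! hlt
  nlinarith

lemma exists_conj_eq_mul (hq : 2 ≤ q) (hF : Fintype.card F = q ^ 2) (hc : ∀ x, c x = x ^ q)
    (hcc : ∀ x, c (c x) = x) {u : F} (hu : c u * u = 1) :
    ∃ x, x ≠ 0 ∧ c x = u * x := by
  have h := ncard_conj_eq_mul hq hF hc hcc hu
  obtain ⟨x, hx, hx0⟩ := Set.exists_ne_of_one_lt_ncard (s := {x : F | c x = u * x})
    (by omega) 0
  exact ⟨x, hx0, hx⟩

lemma exists_conj_ne_mul (hq : 2 ≤ q) (hF : Fintype.card F = q ^ 2) (hc : ∀ x, c x = x ^ q)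
    (u : F) : ∃ x, c x ≠ u * x := by
  by_contra! h
  have h1 := ncard_conj_eq_mul_le hq hc u
  rw [show {x : F | c x = u * x} = Set.univ from Set.eq_univ_of_forall h, Set.ncard_univ,
    Nat.card_eq_fintype_card, hF] at h1
  nlinarith

lemma eq_zero_of_forall_mul_add_mul_conj (hq : 2 ≤ q) (hF : Fintype.card F = q ^ 2)
    (hc : ∀ x, c x = x ^ q) {a b : F} (h : ∀ x, a * x + b * c x = 0) : a = 0 ∧ b = 0 := by
  have h1 := h 1
  obtain ⟨x, hx⟩ := exists_conj_ne_mul hq hF hc 1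
  have hx' := h x
  rw [map_one] at h1
  have hb : b = 0 := by
    have : b * (c x - 1 * x) = 0 := by linear_combination hx' - x * h1
    exact (mul_eq_zero.1 this).resolve_right (sub_ne_zero.2 hx)
  refine ⟨by linear_combination h1 - hb, hb⟩

end conjugation

section points

variable {F : Type} [Field F]

lemma exists_rep_mk_eq_smul (v : Fin 4 → F) (h : v ≠ 0) :
    ∃ k : F, k ≠ 0 ∧ (Projectivization.mk F v h).rep = k • v := by
  obtain ⟨a, ha⟩ := Projectivization.exists_smul_eq_mk_rep F v h
  exact ⟨a, a.ne_zero, ha.symm⟩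

lemma mk_mem_lineThrough {a b v : Fin 4 → F} (ha : a ≠ 0) (hb : b ≠ 0) (hv : v ≠ 0) :
    Projectivization.mk F v hv ∈
        lineThrough F (Projectivization.mk F a ha) (Projectivization.mk F b hb) ↔
      ∃ s t : F, s • a + t • b = v := by
  simp only [lineThrough, Set.mem_ofPred_eq, Projectivization.submodule_mk,
    Submodule.span_singleton_le_iff_mem]
  rw [← Submodule.span_union, Set.singleton_union, Submodule.mem_span_pair]

lemma tau_mk (q : ℕ) (η : F) (v : Fin 4 → F) (h : v ≠ 0) (h' : tauFun q F η v ≠ 0) :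
    tau q F η (Projectivization.mk F v h) = Projectivization.mk F (tauFun q F η v) h' := by
  obtain ⟨k, hk, hr⟩ := exists_rep_mk_eq_smul v h
  have hs : tauFun q F η (Projectivization.mk F v h).rep = k ^ q • tauFun q F η v := by
    rw [hr]
    ext i
    fin_cases i <;> simp [tauFun, mul_pow, mul_left_comm]
  have hne : tauFun q F η (Projectivization.mk F v h).rep ≠ 0 := by
    rw [hs]
    exact smul_ne_zero (pow_ne_zero _ hk) h'
  rw [tau, dif_pos hne, Projectivization.mk_eq_mk_iff']
  exact ⟨k ^ q, hs.symm⟩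

lemma exists_smul_add_smul_of_finrank_eq_two {W : Submodule F (Fin 4 → F)}
    (hW : Module.finrank F W = 2) {a b : Fin 4 → F} (ha : a ∈ W) (hb : b ∈ W)
    (hab : ∀ s t : F, s • a + t • b = 0 → s = 0 ∧ t = 0) {w : Fin 4 → F} (hw : w ∈ W) :
    ∃ s t : F, s • a + t • b = w := by
  have hli : LinearIndependent F ![a, b] := LinearIndependent.pair_iff.2 hab
  have hle : Submodule.span F (Set.range ![a, b]) ≤ W := by
    rw [Submodule.span_le]
    rintro _ ⟨i, rfl⟩
    fin_cases i <;> simpa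
  have heq := Submodule.eq_of_le_of_finrank_eq hle
    (by rw [finrank_span_eq_card hli, hW, Fintype.card_fin])
  rwa [← heq, Matrix.range_cons, Matrix.range_cons, Matrix.range_empty, Set.union_empty,
    Set.singleton_union, Submodule.mem_span_pair] at hw

/-- The line `{(x, y, α (u x + d y), α v y)}`. -/
def graphLine (α u v d : F) : Set (Pt F) :=
  {P | P.rep 2 = α * (u * P.rep 0 + d * P.rep 1) ∧ P.rep 3 = α * (v * P.rep 1)}

lemma mk_mem_graphLine {α u v d : F} {w : Fin 4 → F} (h : w ≠ 0) :
    Projectivization.mk F w h ∈ graphLine α u v d ↔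
      w 2 = α * (u * w 0 + d * w 1) ∧ w 3 = α * (v * w 1) := by
  obtain ⟨k, hk, hr⟩ := exists_rep_mk_eq_smul w h
  simp only [graphLine, Set.mem_ofPred_eq, hr, Pi.smul_apply, smul_eq_mul]
  refine and_congr ?_ ?_
  · rw [show α * (u * (k * w 0) + d * (k * w 1)) = k * (α * (u * w 0 + d * w 1)) by ring,
      mul_right_inj' hk]
  · rw [show α * (v * (k * w 1)) = k * (α * (v * w 1)) by ring, mul_right_inj' hk]

lemma isLine_graphLine (α u v d : F) : isLine F (graphLine α u v d) := by
  have hli : LinearIndependent F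
      ![(![1, 0, α * u, 0] : Fin 4 → F), ![0, 1, α * d, α * v]] := by
    rw [LinearIndependent.pair_iff]
    intro s t h
    have h0 := congrFun h 0
    have h1 := congrFun h 1
    simp at h0 h1
    exact ⟨h0, h1⟩
  refine ⟨Submodule.span F (Set.range ![(![1, 0, α * u, 0] : Fin 4 → F), ![0, 1, α * d, α * v]]),
    by rw [finrank_span_eq_card hli, Fintype.card_fin], ?_⟩
  ext P
  induction P using Projectivization.ind with
  | h w hw =>
    rw [mk_mem_graphLine]
    simp only [Set.mem_ofPred_eq, Projectivization.submodule_mk,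
      Submodule.span_singleton_le_iff_mem, Matrix.range_cons, Matrix.range_empty,
      Set.union_empty, Set.singleton_union, Submodule.mem_span_pair]
    constructor
    · rintro ⟨h2, h3⟩
      refine ⟨w 0, w 1, ?_⟩
      ext i
      fin_cases i <;> simp [h2, h3] <;> ring
    · rintro ⟨s, t, rfl⟩
      constructor <;> simp <;> ring

lemma vec_ne_zero {x y z w : F} (h : x ≠ 0 ∨ y ≠ 0) : ![x, y, z, w] ≠ 0 := by
  intro h0
  have h1 := congrFun h0 0
  have h2 := congrFun h0 1
  simp at h1 h2
  tauto

end points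

section charts

variable {q : ℕ} {F : Type} [Field F] {c : F →+* F} {η : F}

/-- The pairs `(x, y)` for which `(x, y, η xᑫ, η yᑫ)` is a point of `m`. -/
def chart (q : ℕ) (η : F) (m : Set (Pt F)) : Set (F × F) :=
  {p | ∃ h : ![p.1, p.2, η * p.1 ^ q, η * p.2 ^ q] ≠ 0, Projectivization.mk F _ h ∈ m}

lemma eq_of_chart_eq {m m' : Set (Pt F)} (hm : m ⊆ SigmaSet q F η) (hm' : m' ⊆ SigmaSet q F η)
    (h : chart q η m = chart q η m') : m = m' := by
  have key : ∀ {n n' : Set (Pt F)}, n ⊆ SigmaSet q F η → chart q η n = chart q η n' →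
      n ⊆ n' := by
    intro n n' hn h P hP
    obtain ⟨x, y, hxy, rfl⟩ := hn hP
    have : (x, y) ∈ chart q η n := ⟨hxy, hP⟩
    rw [h] at this
    exact this.2
  exact (key hm h).antisymm (key hm' h.symm)

lemma ne_zero_of_mem_chart (hq : q ≠ 0) {m : Set (Pt F)} {p : F × F} (h : p ∈ chart q η m) :
    p.1 ≠ 0 ∨ p.2 ≠ 0 := by
  by_contra! h0
  refine h.1 ?_
  simp [h0.1, h0.2, hq]

lemma mem_chart_inter_iff (hc : ∀ x, c x = x ^ q) (hq : q ≠ 0) {s : Set (Pt F)} {p : F × F} :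
    p ∈ chart q η (s ∩ SigmaSet q F η) ↔
      ∃ h : p.1 ≠ 0 ∨ p.2 ≠ 0,
        Projectivization.mk F ![p.1, p.2, η * c p.1, η * c p.2] (vec_ne_zero h) ∈ s := by
  simp only [hc]
  constructor
  · intro h
    exact ⟨ne_zero_of_mem_chart hq h, h.2.1⟩
  · rintro ⟨h, hs⟩
    exact ⟨vec_ne_zero h, hs, p.1, p.2, vec_ne_zero h, rfl⟩

/-- The nonzero vectors `λ z + λᑫ w`. -/
def linPlane (c : F →+* F) (z w : F × F) : Set (F × F) :=
  {p | (p.1 ≠ 0 ∨ p.2 ≠ 0) ∧ ∃ t : F, p.1 = t * z.1 + c t * w.1 ∧ p.2 = t * z.2 + c t * w.2}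

/-- The second vector `η (M z)ᑫ` of the member of the spread `S_ℓ` given by `(z, M z) ∈ ℓ`. -/
def partner (c : F →+* F) (η α u v d : F) (z : F × F) : F × F :=
  (η * c (α * (u * z.1 + d * z.2)), η * c (α * (v * z.2)))

lemma eq_mk_of_rep_eq {P : Pt F} {v : Fin 4 → F} {h : v ≠ 0} (hP : P.rep = v) :
    P = Projectivization.mk F v h := by
  subst hP
  exact (Projectivization.mk_rep P).symm

lemma chart_rLine_inter (hc : ∀ x, c x = x ^ q) (hq : q ≠ 0) (a b : F) (h : a ≠ 0 ∨ b ≠ 0) :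
    chart q η (rLine q F (Projectivization.mk F ![a, b, 0, 0] (vec_ne_zero h)) ∩
        SigmaSet q F η) =
      {p | (p.1 ≠ 0 ∨ p.2 ≠ 0) ∧ ∃ s, p.1 = s * a ∧ p.2 = s * b} := by
  have ht : tauFun q F 1 ![a, b, 0, 0] = ![0, 0, c a, c b] := by
    ext i
    fin_cases i <;> simp [tauFun, hc, hq]
  have ht0 : tauFun q F 1 ![a, b, 0, 0] ≠ 0 := by
    rw [ht]
    intro h0
    have h1 := congrFun h0 2
    have h2 := congrFun h0 3
    simp at h1 h2
    tauto
  ext p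
  rw [mem_chart_inter_iff hc hq, rLine, tau_mk _ _ _ _ ht0]
  simp only [mk_mem_lineThrough, exists_prop, Set.mem_ofPred_eq]
  refine and_congr_right fun _ => ?_
  rw [ht]
  constructor
  · rintro ⟨s, t, hst⟩
    have h0 := congrFun hst 0
    have h1 := congrFun hst 1
    simp at h0 h1
    exact ⟨s, h0.symm, h1.symm⟩
  · rintro ⟨s, h0, h1⟩
    refine ⟨s, η * c s, ?_⟩
    ext i
    fin_cases i <;> simp [h0, h1, mul_assoc]

lemma rLine_inter_mem_Dspread (a b : F) (h : a ≠ 0 ∨ b ≠ 0) :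
    rLine q F (Projectivization.mk F ![a, b, 0, 0] (vec_ne_zero h)) ∩ SigmaSet q F η ∈
      Dspread q F η := by
  refine ⟨_, ?_, rfl⟩
  obtain ⟨k, -, hr⟩ := exists_rep_mk_eq_smul ![a, b, 0, 0] (vec_ne_zero h)
  simp [t1, hr]

lemma exists_chart_of_mem_Dspread (hc : ∀ x, c x = x ^ q) (hq : q ≠ 0) {m : Set (Pt F)}
    (hm : m ∈ Dspread q F η) : m ⊆ SigmaSet q F η ∧ ∃ a b : F, (a ≠ 0 ∨ b ≠ 0) ∧
      chart q η m = {p | (p.1 ≠ 0 ∨ p.2 ≠ 0) ∧ ∃ s, p.1 = s * a ∧ p.2 = s * b} := by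
  obtain ⟨P, hP, rfl⟩ := hm
  refine ⟨Set.inter_subset_right, ?_⟩
  obtain ⟨h2, h3⟩ := hP
  have hP0 := P.rep_nonzero
  have h : P.rep 0 ≠ 0 ∨ P.rep 1 ≠ 0 := by
    by_contra! h0
    refine hP0 ?_
    ext i
    fin_cases i <;> simp [h0, h2, h3]
  refine ⟨_, _, h, ?_⟩
  rw [← chart_rLine_inter hc hq _ _ h]
  congr 3
  refine eq_mk_of_rep_eq ?_
  ext i
  fin_cases i <;> simp [h2, h3]

lemma norm_mul_ne_one {α u : F} (hα : c α * α ≠ 1) (hu : c u * u = 1) :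
    c (α * u) * (α * u) ≠ 1 := by
  rwa [map_mul, mul_mul_mul_comm, hu, mul_one]

lemma eq_zero_of_mul_conj_eq (hcc : ∀ x, c (c x) = x) (hη : c η * η = 1) {β e x : F}
    (hβ : c β * β ≠ 1) (hx : x ≠ 0) (h : e * c x = η * c e * (β * x)) : e = 0 := by
  by_contra he
  refine hβ ?_
  have h' := congrArg c h
  simp only [map_mul, hcc] at h'
  have hne : e * c e * (x * c x) ≠ 0 := by simp [he, hx]
  refine mul_left_cancel₀ hne ?_
  linear_combination -(c e * x) * h - η * c e * (β * x) * h' - e * c e * (x * c x) * (c β * β) * hη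

lemma chart_Sspread_line (hc : ∀ x, c x = x ^ q) (hcc : ∀ x, c (c x) = x) (hq : q ≠ 0)
    (hη : c η * η = 1) {α u v d : F} (hα1 : c α * α ≠ 1) (hu : c u * u = 1)
    (hv : c v * v = 1) (z : F × F) (h : z.1 ≠ 0 ∨ z.2 ≠ 0) :
    chart q η (lineThrough F
        (Projectivization.mk F ![z.1, z.2, α * (u * z.1 + d * z.2), α * (v * z.2)]
          (vec_ne_zero h))
        (tau q F η (Projectivization.mk F
          ![z.1, z.2, α * (u * z.1 + d * z.2), α * (v * z.2)] (vec_ne_zero h))) ∩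
        SigmaSet q F η) = linPlane c z (partner c η α u v d z) := by
  have ht : tauFun q F η ![z.1, z.2, α * (u * z.1 + d * z.2), α * (v * z.2)] =
      ![c (α * (u * z.1 + d * z.2)), c (α * (v * z.2)), c z.1, c z.2] := by
    have hη' : η ^ (q + 1) = 1 := by rw [pow_succ, ← hc, hη]
    ext i
    fin_cases i <;> simp [tauFun, ← hc, hη']
  have ht0 : tauFun q F η ![z.1, z.2, α * (u * z.1 + d * z.2), α * (v * z.2)] ≠ 0 := by
    rw [ht]
    intro h0
    have h1 := congrFun h0 2
    have h2 := congrFun h0 3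
    simp at h1 h2
    tauto
  ext p
  rw [mem_chart_inter_iff hc hq, tau_mk _ _ _ _ ht0]
  simp only [mk_mem_lineThrough, exists_prop, linPlane, partner, Set.mem_ofPred_eq]
  refine and_congr_right fun _ => ?_
  rw [ht]
  constructor
  · rintro ⟨s, t, hst⟩
    have h0 := congrFun hst 0
    have h1 := congrFun hst 1
    have h2 := congrFun hst 2
    have h3 := congrFun hst 3
    simp only [Pi.add_apply, Pi.smul_apply, smul_eq_mul, Matrix.cons_val] at h0 h1 h2 h3
    have h0' := congrArg c h0
    have h1' := congrArg c h1
    simp only [map_add, map_mul c t, hcc] at h0' h1'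
    simp only [map_mul c s] at h0' h1'
    have he : t - η * c s = 0 := by
      have e1 : (t - η * c s) * c z.2 = η * c (t - η * c s) * (α * v * z.2) := by
        simp only [map_sub, map_mul, hcc]
        linear_combination h3 - η * h1' + α * v * z.2 * s * hη
      have e2 : (t - η * c s) * c z.1 =
          η * c (t - η * c s) * (α * (u * z.1 + d * z.2)) := by
        simp only [map_sub, map_mul, hcc]
        linear_combination h2 - η * h0' + α * (u * z.1 + d * z.2) * s * hη
      by_cases hz : z.2 = 0
      · refine eq_zero_of_mul_conj_eq hcc hη (norm_mul_ne_one hα1 hu)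
          (h.resolve_right (not_not.2 hz)) (e2.trans ?_)
        rw [hz]
        ring
      · exact eq_zero_of_mul_conj_eq hcc hη (norm_mul_ne_one hα1 hv) hz e1
    refine ⟨s, ?_, ?_⟩
    · linear_combination -h0 + c (α * (u * z.1 + d * z.2)) * he
    · linear_combination -h1 + c (α * (v * z.2)) * he
  · rintro ⟨s, h0, h1⟩
    refine ⟨s, η * c s, ?_⟩
    ext i
    fin_cases i
    · simp [h0]; ring
    · simp [h1]; ring
    · simp [h0, hcc]; linear_combination -s * α * (u * z.1 + d * z.2) * hη
    · simp [h1, hcc]; linear_combination -s * α * v * z.2 * hη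

lemma mem_Sspread_iff (hc : ∀ x, c x = x ^ q) (hcc : ∀ x, c (c x) = x) (hq : q ≠ 0)
    (hη : c η * η = 1) {α u v d : F} (hα1 : c α * α ≠ 1) (hu : c u * u = 1)
    (hv : c v * v = 1) {m : Set (Pt F)} :
    m ∈ Sspread q F η (graphLine α u v d) ↔ m ⊆ SigmaSet q F η ∧
      ∃ z : F × F, (z.1 ≠ 0 ∨ z.2 ≠ 0) ∧
        chart q η m = linPlane c z (partner c η α u v d z) := by
  constructor
  · rintro ⟨Q, hQ, rfl⟩
    refine ⟨Set.inter_subset_right, ?_⟩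
    obtain ⟨h2, h3⟩ := hQ
    have hP0 := Q.rep_nonzero
    have h : Q.rep 0 ≠ 0 ∨ Q.rep 1 ≠ 0 := by
      by_contra! h0
      refine hP0 ?_
      ext i
      fin_cases i <;> simp [h0, h2, h3]
    refine ⟨(Q.rep 0, Q.rep 1), h, ?_⟩
    rw [← chart_Sspread_line hc hcc hq hη hα1 hu hv _ h]
    have hQ' : Q = Projectivization.mk F ![Q.rep 0, Q.rep 1,
        α * (u * Q.rep 0 + d * Q.rep 1), α * (v * Q.rep 1)] (vec_ne_zero h) := by
      refine eq_mk_of_rep_eq ?_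
      ext i
      fin_cases i <;> simp [h2, h3]
    rw [← hQ']
  · rintro ⟨hm, z, h, hch⟩
    refine ⟨Projectivization.mk F ![z.1, z.2, α * (u * z.1 + d * z.2), α * (v * z.2)]
      (vec_ne_zero h), ?_, ?_⟩
    · rw [mk_mem_graphLine]
      simp
    · exact eq_of_chart_eq hm Set.inter_subset_right (hch.trans (chart_Sspread_line hc hcc hq hη hα1 hu hv z h).symm)

end charts

section pencils

variable {q : ℕ} {F : Type} [Field F] {c : F →+* F}

lemma ncard_graphLine_inter [Fintype F] (hq : 2 ≤ q) (hF : Fintype.card F = q ^ 2)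
    (hc : ∀ x, c x = x ^ q) (hcc : ∀ x, c (c x) = x) {α u v : F} (hα : α ≠ 0)
    (hu : c u * u = 1) (hv : c v * v = 1) :
    (graphLine α u v 0 ∩ SigmaSet q F α).ncard = q + 1 := by
  have hρ : c (v * c u) * (v * c u) = 1 := by
    rw [map_mul, hcc]
    linear_combination c v * v * hu + hv
  let f : F → Pt F := fun k =>
    Projectivization.mk F ![1, k, α * u, α * (v * k)] (vec_ne_zero (Or.inl one_ne_zero))
  let P : Pt F := Projectivization.mk F ![0, 1, 0, α * v] (vec_ne_zero (Or.inr one_ne_zero))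
  have hf : Function.Injective f := by
    intro k l h
    obtain ⟨a, ha⟩ := (Projectivization.mk_eq_mk_iff' _ _ _ _ _).1 h
    have h0 := congrFun ha 0
    have h1 := congrFun ha 1
    simp at h0 h1
    rw [← h1, h0, one_mul]
  have hP : P ∉ f '' {x : F | c x = v * c u * x} := by
    rintro ⟨k, -, h⟩
    obtain ⟨a, ha⟩ := (Projectivization.mk_eq_mk_iff' _ _ _ _ _).1 h
    have h0 := congrFun ha 0
    simp at h0
  have heq : graphLine α u v 0 ∩ SigmaSet q F α = insert P (f '' {x : F | c x = v * c u * x}) := by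
    ext Q
    constructor
    · rintro ⟨hQ, x, y, hxy, rfl⟩
      rw [mk_mem_graphLine] at hQ
      simp only [Matrix.cons_val, zero_mul, add_zero, mul_right_inj' hα, ← hc] at hQ
      obtain ⟨hx, hy⟩ := hQ
      by_cases hx0 : x = 0
      · left
        rw [Projectivization.mk_eq_mk_iff']
        refine ⟨y, ?_⟩
        ext i
        fin_cases i <;> simp [hx0, ← hc, hy, mul_left_comm, mul_comm]
      · right
        refine ⟨x⁻¹ * y, ?_, ?_⟩
        · have hcx : c x ≠ 0 := (map_ne_zero c).2 hx0
          simp only [Set.mem_ofPred_eq, map_mul, map_inv₀]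
          rw [hy, hx]
          have hu0 := right_ne_zero_of_mul_eq_one hu
          field_simp
          linear_combination -(v * y) * hu
        · rw [Projectivization.mk_eq_mk_iff']
          refine ⟨x⁻¹, ?_⟩
          ext i
          fin_cases i <;> simp [hx0, ← hc, hx, hy] <;> field_simp
    · rintro (rfl | ⟨k, hk, rfl⟩)
      · refine ⟨by simp [P, mk_mem_graphLine], ?_⟩
        obtain ⟨y, hy0, hy⟩ := exists_conj_eq_mul hq hF hc hcc hv
        refine ⟨0, y, vec_ne_zero (Or.inr hy0), ?_⟩
        rw [Projectivization.mk_eq_mk_iff']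
        refine ⟨y⁻¹, ?_⟩
        ext i
        fin_cases i <;> simp [hy0, ← hc, hy]
        field_simp
      · refine ⟨by simp [f, mk_mem_graphLine], ?_⟩
        obtain ⟨x, hx0, hx⟩ := exists_conj_eq_mul hq hF hc hcc hu
        refine ⟨x, x * k, vec_ne_zero (Or.inl hx0), ?_⟩
        rw [Projectivization.mk_eq_mk_iff']
        have hk' : c k = v * c u * k := hk
        refine ⟨x⁻¹, ?_⟩
        ext i
        fin_cases i <;> simp [hx0, ← hc, hx, hk']
        · field_simp
        · field_simp
          linear_combination (v * k) * hu
  rw [heq, Set.ncard_insert_of_notMem hP (Set.toFinite _), Set.ncard_image_of_injective _ hf,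
    ncard_conj_eq_mul hq hF hc hcc hρ]

lemma graphLine_mem_pencil [Fintype F] (hq : 2 ≤ q) (hF : Fintype.card F = q ^ 2)
    (hc : ∀ x, c x = x ^ q) (hcc : ∀ x, c (c x) = x) {α u v : F} (hα : α ≠ 0)
    (hu : c u * u = 1) (hv : c v * v = 1) :
    graphLine α u v 0 ∈ pencil q F α u v \ {rU1 F} := by
  refine ⟨⟨isLine_graphLine _ _ _ _, ?_, ?_, ncard_graphLine_inter hq hF hc hcc hα hu hv⟩, ?_⟩
  · simp [Ppt, mk_mem_graphLine]
  · intro P hP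
    simpa [planeSet, mul_assoc] using hP.2
  · intro h
    have h1 : Projectivization.mk F ![0, 1, 0, α * v] (vec_ne_zero (Or.inr one_ne_zero)) ∈
        rU1 F := by
      rw [← Set.mem_singleton_iff.1 h]
      simp [mk_mem_graphLine]
    obtain ⟨k, hk, hr⟩ := exists_rep_mk_eq_smul (F := F) ![0, 1, 0, α * v]
      (vec_ne_zero (Or.inr one_ne_zero))
    obtain ⟨h2, -⟩ := h1
    rw [hr] at h2
    simp [hk] at h2

lemma exists_eq_graphLine_of_mem_pencil (hq : 2 ≤ q) (hc : ∀ x, c x = x ^ q) {α u v : F}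
    (hα : α ≠ 0) {ℓ : Set (Pt F)} (hℓ : ℓ ∈ pencil q F α u v \ {rU1 F}) :
    ∃ d, ℓ = graphLine α u v d ∧ ∃ x y, y ≠ 0 ∧ c x = u * x + d * y ∧ c y = v * y := by
  obtain ⟨⟨⟨W, hW, rfl⟩, hP, hpl, hcard⟩, hne⟩ := hℓ
  have hmem : ∀ (w : Fin 4 → F) (hw : w ≠ 0),
      Projectivization.mk F w hw ∈ {P : Pt F | P.submodule ≤ W} ↔ w ∈ W := by
    intro w hw
    simp [Projectivization.submodule_mk]
  have hp : ![1, 0, α * u, 0] ∈ W := (hmem _ _).1 hP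
  have hpl' : ∀ w ∈ W, w 3 = α * v * w 1 := by
    intro w hw
    by_cases hw0 : w = 0
    · simp [hw0]
    · obtain ⟨k, hk, hr⟩ := exists_rep_mk_eq_smul w hw0
      have h1 := hpl ((hmem w hw0).2 hw)
      simp only [planeSet, Set.mem_ofPred_eq, hr, Pi.smul_apply, smul_eq_mul] at h1
      refine mul_left_cancel₀ hk ?_
      linear_combination h1
  have hex : ∃ w ∈ W, w 1 ≠ 0 := by
    by_contra! hall
    refine hne ?_
    obtain ⟨b, hb, hbs⟩ : ∃ b ∈ W, b ∉ Submodule.span F {![1, 0, α * u, 0]} := by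
      by_contra! hle
      have := Submodule.finrank_mono (show W ≤ Submodule.span F {![1, 0, α * u, 0]} from hle)
      have h1 := finrank_span_singleton (K := F)
        (vec_ne_zero (F := F) (x := 1) (y := 0) (z := α * u) (w := 0) (Or.inl one_ne_zero))
      rw [hW, h1] at this
      omega
    have hb1 := hall b hb
    have hb3 := hpl' b hb
    rw [hb1, mul_zero] at hb3
    have hD : b 2 - b 0 * α * u ≠ 0 := by
      intro h
      refine hbs (Submodule.mem_span_singleton.2 ⟨b 0, ?_⟩)
      ext i
      fin_cases i <;> simp [hb1, hb3]
      linear_combination -h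
    ext P
    induction P using Projectivization.ind with
    | h w hw =>
      rw [hmem]
      obtain ⟨k, hk, hr⟩ := exists_rep_mk_eq_smul w hw
      simp only [rU1, Set.mem_ofPred_eq, hr, Pi.smul_apply, smul_eq_mul, mul_eq_zero, hk, false_or]
      constructor
      · intro h
        exact ⟨hall w h, by rw [hpl' w h, hall w h, mul_zero]⟩
      · rintro ⟨h1, h3⟩
        have : w = ((w 0 * b 2 - w 2 * b 0) / (b 2 - b 0 * α * u)) • ![1, 0, α * u, 0] +
            ((w 2 - α * u * w 0) / (b 2 - b 0 * α * u)) • b := by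
          ext i
          fin_cases i <;> simp [h1, h3, hb1, hb3] <;> field_simp <;> ring
        rw [this]
        exact W.add_mem (W.smul_mem _ hp) (W.smul_mem _ hb)
  obtain ⟨b, hb, hb1⟩ := hex
  have hb3 := hpl' b hb
  have heq : {P : Pt F | P.submodule ≤ W} =
      graphLine α u v ((b 2 - α * u * b 0) / (α * b 1)) := by
    ext P
    induction P using Projectivization.ind with
    | h w hw =>
      rw [hmem, mk_mem_graphLine]
      constructor
      · intro h
        refine ⟨?_, by rw [hpl' w h]; ring⟩
        obtain ⟨s, t, rfl⟩ := exists_smul_add_smul_of_finrank_eq_two hW hp hb (by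
          intro s t hst
          have h0 := congrFun hst 0
          have h1 := congrFun hst 1
          simp [hb1] at h0 h1
          simp [h1] at h0
          exact ⟨h0, h1⟩) h
        simp
        field_simp
        ring
      · rintro ⟨h2, h3⟩
        have : w = (w 0 - w 1 / b 1 * b 0) • ![1, 0, α * u, 0] + (w 1 / b 1) • b := by
          ext i
          fin_cases i <;> simp [h2, h3, hb3] <;> field_simp
          ring
        rw [this]
        exact W.add_mem (W.smul_mem _ hp) (W.smul_mem _ hb)
  refine ⟨_, heq, ?_⟩
  rw [heq] at hcard
  obtain ⟨Q, ⟨hQ, x, y, hxy, rfl⟩, hQP⟩ := Set.exists_ne_of_one_lt_ncard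
    (by rw [hcard]; omega) (Ppt F α u)
  rw [mk_mem_graphLine] at hQ
  simp only [Matrix.cons_val, mul_right_inj' hα, ← hc] at hQ
  refine ⟨x, y, ?_, hQ⟩
  rintro rfl
  refine hQP ?_
  rw [Ppt, Projectivization.mk_eq_mk_iff']
  refine ⟨x, ?_⟩
  ext i
  fin_cases i <;> simp [← hc, hQ.1]
  ring

end pencils

section reguli

variable {q : ℕ} {F : Type} [Field F] {c : F →+* F} {η : F}

/-- The nonzero vectors `p` with `pᑫ = ρ M p`, where `M` is upper triangular with entries
`u, d, v`. -/
def fixedPlane (c : F →+* F) (ρ u v d : F) : Set (F × F) :=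
  {p | (p.1 ≠ 0 ∨ p.2 ≠ 0) ∧ c p.1 = ρ * (u * p.1 + d * p.2) ∧ c p.2 = ρ * (v * p.2)}

lemma exists_mem_Sspread (hc : ∀ x, c x = x ^ q) (hcc : ∀ x, c (c x) = x) (hq : q ≠ 0)
    (hη : c η * η = 1) {α u v d : F} (hα1 : c α * α ≠ 1) (hu : c u * u = 1)
    (hv : c v * v = 1) {z : F × F} (hz : z.1 ≠ 0 ∨ z.2 ≠ 0) :
    ∃ m ∈ Sspread q F η (graphLine α u v d),
      chart q η m = linPlane c z (partner c η α u v d z) :=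
  ⟨_, ⟨Projectivization.mk F ![z.1, z.2, α * (u * z.1 + d * z.2), α * (v * z.2)]
    (vec_ne_zero hz), by simp [mk_mem_graphLine], rfl⟩,
    chart_Sspread_line hc hcc hq hη hα1 hu hv z hz⟩

lemma exists_smul_mem_chart_of_mem_Ropp (hc : ∀ x, c x = x ^ q) (hcc : ∀ x, c (c x) = x)
    (hq : q ≠ 0) (hη : c η * η = 1) {α u v d : F} (hα1 : c α * α ≠ 1) (hu : c u * u = 1)
    (hv : c v * v = 1) {m : Set (Pt F)} (hm : m ∈ Ropp q F η (graphLine α u v d))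
    {z : F × F} (hz : z.1 ≠ 0 ∨ z.2 ≠ 0) (h1 : c z.1 = u * z.1 + d * z.2)
    (h2 : c z.2 = v * z.2) : ∃ t, t ≠ 0 ∧ (t * z.1, t * z.2) ∈ chart q η m := by
  obtain ⟨D, hD⟩ : ∃ D, D * (1 - c α * α) = 1 :=
    ⟨(1 - c α * α)⁻¹, inv_mul_cancel₀ (sub_ne_zero.2 hα1.symm)⟩
  have hcD : c D = D := by
    have h := congrArg c hD
    simp only [map_mul, map_sub, map_one, hcc] at h
    linear_combination D * h - c D * hD
  have hmem : rLine q F (Projectivization.mk F ![z.1, z.2, 0, 0] (vec_ne_zero hz)) ∩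
      SigmaSet q F η ∈ Rreg q F η (graphLine α u v d) := by
    refine ⟨rLine_inter_mem_Dspread _ _ hz,
      (mem_Sspread_iff hc hcc hq hη hα1 hu hv).2 ⟨Set.inter_subset_right, z, hz, ?_⟩⟩
    rw [chart_rLine_inter hc hq _ _ hz]
    ext p
    simp only [linPlane, partner, Set.mem_ofPred_eq]
    refine and_congr_right fun _ => ?_
    rw [map_mul, map_mul, ← h1, ← h2, hcc, hcc]
    constructor
    · rintro ⟨s, hs1, hs2⟩
      refine ⟨D * (s - η * c α * c s), ?_, ?_⟩
      · rw [hs1]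
        simp only [map_sub, map_mul, hcc, hcD]
        linear_combination -(s * z.1) * hD + D * s * z.1 * c α * α * hη
      · rw [hs2]
        simp only [map_sub, map_mul, hcc, hcD]
        linear_combination -(s * z.2) * hD + D * s * z.2 * c α * α * hη
    · rintro ⟨t, ht1, ht2⟩
      refine ⟨t + c t * (η * c α), ?_, ?_⟩
      · rw [ht1]; ring
      · rw [ht2]; ring
  obtain ⟨P, hPm, hP⟩ := hm.2 _ hmem
  obtain ⟨x, y, hxy, rfl⟩ := hP.2
  have hch : (x, y) ∈ chart q η (rLine q F (Projectivization.mk F ![z.1, z.2, 0, 0]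
      (vec_ne_zero hz)) ∩ SigmaSet q F η) := ⟨hxy, hP⟩
  rw [chart_rLine_inter hc hq _ _ hz] at hch
  obtain ⟨hne, s, hs1, hs2⟩ := hch
  simp only at hne hs1 hs2
  refine ⟨s, ?_, ?_⟩
  · rintro rfl
    simp [hs1, hs2] at hne
  · rw [← hs1, ← hs2]
    exact ⟨hxy, hPm⟩

lemma exists_chart_eq_of_mem_Ropp (hc : ∀ x, c x = x ^ q) (hcc : ∀ x, c (c x) = x)
    (hq : q ≠ 0) (hη : c η * η = 1) {α u v d : F} (hα1 : c α * α ≠ 1) (hu : c u * u = 1)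
    (hv : c v * v = 1) {m : Set (Pt F)} (hm : m ∈ Ropp q F η (graphLine α u v d))
    {a x y : F} (ha : a ≠ 0) (hy : y ≠ 0) (hca : c a = u * a) (hcx : c x = u * x + d * y)
    (hcy : c y = v * y) :
    ∃ ρ, chart q η m = fixedPlane c ρ u v d ∧ ∃ p ∈ chart q η m, p.2 ≠ 0 := by
  obtain ⟨l, hl0, hl⟩ := exists_smul_mem_chart_of_mem_Ropp hc hcc hq hη hα1 hu hv hm
    (z := (a, 0)) (Or.inl ha) (by simp [hca]) (by simp)
  obtain ⟨r, hr0, hr⟩ := exists_smul_mem_chart_of_mem_Ropp hc hcc hq hη hα1 hu hv hm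
    (z := (x, y)) (Or.inr hy) hcx hcy
  obtain ⟨k, hk0, hk⟩ := exists_smul_mem_chart_of_mem_Ropp hc hcc hq hη hα1 hu hv hm
    (z := (a + x, y)) (Or.inr hy) (by simp only [map_add, hca, hcx]; ring) hcy
  obtain ⟨s, ⟨W, hW, rfl⟩, hms, -⟩ := hm.1
  have hmem : ∀ p : F × F, p ∈ chart q η m ↔
      (p.1 ≠ 0 ∨ p.2 ≠ 0) ∧ ![p.1, p.2, η * c p.1, η * c p.2] ∈ W := by
    intro p
    rw [hms, mem_chart_inter_iff hc hq]
    simp [Projectivization.submodule_mk]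
  have hη0 : η ≠ 0 := right_ne_zero_of_mul_eq_one hη
  have hv0 : v ≠ 0 := right_ne_zero_of_mul_eq_one hv
  have hu0 : u ≠ 0 := right_ne_zero_of_mul_eq_one hu
  have hlW := ((hmem _).1 hl).2
  have hrW := ((hmem _).1 hr).2
  have hkW := ((hmem _).1 hk).2
  have hcomb : ∀ w ∈ W, ∃ s t : F, s • ![l * a, l * 0, η * c (l * a), η * c (l * 0)] +
      t • ![r * x, r * y, η * c (r * x), η * c (r * y)] = w := by
    intro w hw
    refine exists_smul_add_smul_of_finrank_eq_two hW hlW hrW ?_ hw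
    intro s t h
    have h0 := congrFun h 0
    have h1 := congrFun h 1
    simp [hr0, hy] at h0 h1
    simp [h1, hl0, ha] at h0
    exact ⟨h0, h1⟩
  have hlr : c l * r = l * c r := by
    obtain ⟨s, t, hst⟩ := hcomb _ hkW
    have h0 := congrFun hst 0
    have h1 := congrFun hst 1
    have h2 := congrFun hst 2
    have h3 := congrFun hst 3
    simp only [Pi.add_apply, Pi.smul_apply, smul_eq_mul, Matrix.cons_val, map_mul, map_add,
      hcy, map_zero, mul_zero, zero_add] at h0 h1 h2 h3
    have e1 : t * r = k := mul_right_cancel₀ hy (by linear_combination h1)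
    have e3 : t * c r = c k :=
      mul_right_cancel₀ (mul_ne_zero hη0 (mul_ne_zero hv0 hy)) (by linear_combination h3)
    have e0 : s * l = k := mul_right_cancel₀ ha (by linear_combination h0 - x * e1)
    have e2 : s * c l = c k :=
      mul_right_cancel₀ (mul_ne_zero hη0 (mul_ne_zero hu0 ha))
        (by linear_combination h2 - η * s * c l * hca - η * c x * e3 + η * c k * hca)
    have hs0 : s ≠ 0 := by rintro rfl; simp at e0; exact hk0 e0.symm
    have ht0 : t ≠ 0 := by rintro rfl; simp at e1; exact hk0 e1.symm
    refine mul_left_cancel₀ (mul_ne_zero hs0 ht0) ?_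
    linear_combination t * r * e2 + c k * e1 - t * c r * e0 - k * e3
  refine ⟨c l / l, ?_, (r * x, r * y), hr, mul_ne_zero hr0 hy⟩
  ext p
  rw [hmem, fixedPlane, Set.mem_ofPred_eq]
  refine and_congr_right fun _ => ?_
  constructor
  · intro hp
    obtain ⟨s, t, hst⟩ := hcomb _ hp
    have h0 := congrFun hst 0
    have h1 := congrFun hst 1
    have h2 := congrFun hst 2
    have h3 := congrFun hst 3
    simp only [Pi.add_apply, Pi.smul_apply, smul_eq_mul, Matrix.cons_val, map_mul,
      map_zero, mul_zero, zero_add, hca, hcx, hcy] at h0 h1 h2 h3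
    constructor
    · refine mul_left_cancel₀ hη0 ?_
      rw [← h2, ← h0, ← h1]
      field_simp
      linear_combination -(t * (u * x + d * y)) * hlr
    · refine mul_left_cancel₀ hη0 ?_
      rw [← h3, ← h1]
      field_simp
      linear_combination -t * hlr
  · rintro ⟨h1, h2⟩
    have : ![p.1, p.2, η * c p.1, η * c p.2] =
        ((p.1 - p.2 / y * x) / (l * a)) • ![l * a, l * 0, η * c (l * a), η * c (l * 0)] +
        (p.2 / (r * y)) • ![r * x, r * y, η * c (r * x), η * c (r * y)] := by
      ext i
      fin_cases i
      · simp; field_simp; ring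
      · simp; field_simp
      · simp [h1, hca, hcx]
        field_simp
        linear_combination (p.2 * (u * x + d * y)) * hlr
      · simp [h2, hcy]
        field_simp
        linear_combination p.2 * hlr
    rw [this]
    exact W.add_mem (W.smul_mem _ hlW) (W.smul_mem _ hrW)

lemma exists_of_chart_eq_linPlane_of_mem_Dspread [Fintype F] (hq : 2 ≤ q)
    (hF : Fintype.card F = q ^ 2) (hc : ∀ x, c x = x ^ q)
    {m : Set (Pt F)} (hm : m ∈ Dspread q F η) {z w : F × F} (hch : chart q η m = linPlane c z w) :
    ∃ a b : F, (a ≠ 0 ∨ b ≠ 0) ∧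
      chart q η m = {p | (p.1 ≠ 0 ∨ p.2 ≠ 0) ∧ ∃ s, p.1 = s * a ∧ p.2 = s * b} ∧
      z.1 * b = z.2 * a ∧ w.1 * b = w.2 * a := by
  obtain ⟨-, a, b, hab, hD⟩ := exists_chart_of_mem_Dspread hc (by omega) hm
  have h := eq_zero_of_forall_mul_add_mul_conj (a := z.1 * b - z.2 * a)
    (b := w.1 * b - w.2 * a) hq hF hc (by
    intro t
    by_cases h0 : t * z.1 + c t * w.1 ≠ 0 ∨ t * z.2 + c t * w.2 ≠ 0
    · have hmem : (t * z.1 + c t * w.1, t * z.2 + c t * w.2) ∈ chart q η m := by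
        rw [hch]
        exact ⟨h0, t, rfl, rfl⟩
      rw [hD] at hmem
      obtain ⟨-, s, h1, h2⟩ := hmem
      simp only at h1 h2
      linear_combination b * h1 - a * h2
    · push Not at h0
      linear_combination b * h0.1 - a * h0.2)
  exact ⟨a, b, hab, hD, sub_eq_zero.1 h.1, sub_eq_zero.1 h.2⟩

lemma chart_graphLine_inter (hc : ∀ x, c x = x ^ q) (hq : q ≠ 0) (hη : η ≠ 0) (u v : F) :
    chart q η (graphLine η u v 0 ∩ SigmaSet q F η) = fixedPlane c 1 u v 0 := by
  ext p
  rw [mem_chart_inter_iff hc hq]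
  simp only [mk_mem_graphLine, exists_prop, fixedPlane, Set.mem_ofPred_eq]
  simp [hη]

lemma graphLine_inter_mem_Ropp [Fintype F] (hq : 2 ≤ q) (hF : Fintype.card F = q ^ 2)
    (hc : ∀ x, c x = x ^ q) (hcc : ∀ x, c (c x) = x) (hη : c η * η = 1) {α u v : F}
    (hα : α ≠ 0) (hα1 : c α * α ≠ 1) (hu : c u * u = 1) (hv : c v * v = 1) :
    graphLine η u v 0 ∩ SigmaSet q F η ∈ Ropp q F η (graphLine α u v 0) := by
  have hη0 : η ≠ 0 := right_ne_zero_of_mul_eq_one hη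
  refine ⟨⟨_, isLine_graphLine _ _ _ _, rfl, ncard_graphLine_inter hq hF hc hcc hη0 hu hv⟩, ?_⟩
  rintro m ⟨hD, hS⟩
  obtain ⟨-, z, hz, hch⟩ := (mem_Sspread_iff hc hcc (by omega) hη hα1 hu hv).1 hS
  obtain ⟨a, b, hab, hDch, hzab, hwab⟩ :=
    exists_of_chart_eq_linPlane_of_mem_Dspread hq hF hc hD hch
  have hzw : c z.1 * c u * b = c z.2 * c v * a := by
    simp only [partner, zero_mul, add_zero, map_mul] at hwab
    refine mul_left_cancel₀ (mul_ne_zero hη0 ((map_ne_zero c).2 hα)) ?_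
    linear_combination hwab
  obtain ⟨t, ht0, ht1, ht2⟩ : ∃ t, t ≠ 0 ∧ c (t * a) = u * (t * a) ∧ c (t * b) = v * (t * b) := by
    have hE : c a * v * b = c b * u * a := by
      by_cases ha : a = 0
      · simp [ha]
      have hz1 : z.1 ≠ 0 := by
        intro h1
        have h2 : z.2 = 0 := by simpa [h1, ha] using hzab.symm
        simp [h1, h2] at hz
      refine mul_left_cancel₀ ((map_ne_zero c).2 hz1) ?_
      have h := congrArg c hzab
      simp only [map_mul] at h
      linear_combination c a * u * v * hzw - u * v * c v * a * h -
        c z.1 * c a * v * b * hu + c z.1 * u * c b * a * hv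
    by_cases ha : a = 0
    · have hb : b ≠ 0 := by simpa [ha] using hab
      obtain ⟨x, hx0, hx⟩ := exists_conj_eq_mul hq hF hc hcc hv
      exact ⟨x / b, div_ne_zero hx0 hb, by simp [ha], by rw [div_mul_cancel₀ _ hb, hx]⟩
    · obtain ⟨x, hx0, hx⟩ := exists_conj_eq_mul hq hF hc hcc hu
      have hca : c a ≠ 0 := (map_ne_zero c).2 ha
      refine ⟨x / a, div_ne_zero hx0 ha, by rw [div_mul_cancel₀ _ ha, hx], ?_⟩
      rw [map_mul, map_div₀, hx]
      field_simp
      linear_combination -hE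
  have hmem : (t * a, t * b) ∈ chart q η m := by
    rw [hDch]
    exact ⟨by simpa [ht0] using hab, t, rfl, rfl⟩
  have hmem' : (t * a, t * b) ∈ chart q η (graphLine η u v 0 ∩ SigmaSet q F η) := by
    rw [chart_graphLine_inter hc (by omega) hη0]
    exact ⟨by simpa [ht0] using hab, by simpa using ht1, by simpa using ht2⟩
  exact ⟨_, hmem'.2, hmem.2⟩

lemma eq_of_linPlane_eq_fixedPlane [Fintype F] (hq : 2 ≤ q) (hF : Fintype.card F = q ^ 2)
    (hc : ∀ x, c x = x ^ q) (hcc : ∀ x, c (c x) = x) {z w : F × F} {ρ u v d : F}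
    (h : linPlane c z w = fixedPlane c ρ u v d) :
    c z.2 = ρ * (v * w.2) ∧ c w.2 = ρ * (v * z.2) := by
  have h1 := eq_zero_of_forall_mul_add_mul_conj (a := c w.2 - ρ * (v * z.2))
    (b := c z.2 - ρ * (v * w.2)) hq hF hc (by
    intro t
    by_cases h0 : t * z.1 + c t * w.1 ≠ 0 ∨ t * z.2 + c t * w.2 ≠ 0
    · have hmem : (t * z.1 + c t * w.1, t * z.2 + c t * w.2) ∈ linPlane c z w :=
        ⟨h0, t, rfl, rfl⟩
      rw [h] at hmem
      obtain ⟨-, -, h2⟩ := hmem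
      simp only [map_add, map_mul, hcc] at h2
      linear_combination h2
    · push Not at h0
      have h2 := congrArg c h0.2
      simp only [map_add, map_mul, hcc, map_zero] at h2
      linear_combination h2 - ρ * v * h0.2)
  exact ⟨sub_eq_zero.1 h1.2, sub_eq_zero.1 h1.1⟩

lemma linPlane_partner_ne_fixedPlane [Fintype F] (hq : 2 ≤ q) (hF : Fintype.card F = q ^ 2)
    (hc : ∀ x, c x = x ^ q) (hcc : ∀ x, c (c x) = x) (hη : c η * η = 1) {α u v d : F}
    (hα1 : c α * α ≠ 1) (hv : c v * v = 1) {z : F × F} {ρ u' v' d' : F}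
    (h : linPlane c z (partner c η α u v d z) = fixedPlane c ρ u' v' d') {p : F × F}
    (hp : p ∈ fixedPlane c ρ u' v' d') : p.2 = 0 := by
  obtain ⟨h1, h2⟩ := eq_of_linPlane_eq_fixedPlane hq hF hc hcc h
  rw [← h] at hp
  simp only [partner, map_mul, hcc] at h1 h2
  by_cases hz : z.2 = 0
  · obtain ⟨-, t, -, ht⟩ := hp
    simpa [partner, hz] using ht
  · refine absurd ?_ hα1
    have hcz : c z.2 ≠ 0 := (map_ne_zero c).2 hz
    have e1 : ρ * v' = c η * (α * v) := mul_right_cancel₀ hz (by linear_combination -h2)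
    refine mul_right_cancel₀ hcz ?_
    linear_combination -h1 - η * c α * c v * c z.2 * e1 - c α * α * c v * v * c z.2 * hη -
      c α * α * c z.2 * hv

end reguli

section main

variable {q : ℕ} {F : Type} [Field F] {c : F →+* F} {η : F}

lemma eq_zero_of_smul_add_smul {z w : F × F} (hδ : z.1 * w.2 - z.2 * w.1 ≠ 0) {X Y : F}
    (h1 : X * z.1 + Y * w.1 = 0) (h2 : X * z.2 + Y * w.2 = 0) : X = 0 ∧ Y = 0 := by
  constructor
  · refine mul_left_cancel₀ hδ ?_
    linear_combination w.2 * h1 - w.1 * h2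
  · refine mul_left_cancel₀ hδ ?_
    linear_combination z.1 * h2 - z.2 * h1

lemma exists_smul_add_smul_of_det_ne_zero {z w : F × F} (hδ : z.1 * w.2 - z.2 * w.1 ≠ 0)
    (p : F × F) : ∃ X Y, p.1 = X * z.1 + Y * w.1 ∧ p.2 = X * z.2 + Y * w.2 := by
  obtain ⟨D, hD⟩ : ∃ D, D * (z.1 * w.2 - z.2 * w.1) = 1 := ⟨_, inv_mul_cancel₀ hδ⟩
  refine ⟨D * (p.1 * w.2 - p.2 * w.1), D * (z.1 * p.2 - z.2 * p.1), ?_, ?_⟩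
  · linear_combination -p.1 * hD
  · linear_combination -p.2 * hD

/-- Two spreads attached to lines with proportional diagonal data that share a line outside
`D_η` have parameters that are equal or conjugate-inverse. -/
lemma eq_or_conj_mul_eq_one_of_linPlane_partner_eq [Fintype F] (hq : 2 ≤ q)
    (hF : Fintype.card F = q ^ 2) (hc : ∀ x, c x = x ^ q) (hcc : ∀ x, c (c x) = x)
    (hη : c η * η = 1) {α θ u v : F} (hα : α ≠ 0) (hu : c u * u = 1) (hv : c v * v = 1)
    {z z' : F × F}
    (hδ : z.1 * (partner c η α u v 0 z).2 - z.2 * (partner c η α u v 0 z).1 ≠ 0)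
    (hz' : z'.1 ≠ 0 ∨ z'.2 ≠ 0)
    (h : linPlane c z (partner c η α u v 0 z) = linPlane c z' (partner c η θ u v 0 z')) :
    θ = α ∨ c θ * α = 1 := by
  obtain ⟨a, e, ha1, ha2⟩ := exists_smul_add_smul_of_det_ne_zero hδ z'
  obtain ⟨b, f, hb1, hb2⟩ := exists_smul_add_smul_of_det_ne_zero hδ (partner c η θ u v 0 z')
  have hef := eq_zero_of_forall_mul_add_mul_conj (a := c b - e) (b := c a - f) hq hF hc (by
    intro t
    by_cases h0 : t * z'.1 + c t * (partner c η θ u v 0 z').1 ≠ 0 ∨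
        t * z'.2 + c t * (partner c η θ u v 0 z').2 ≠ 0
    · have hmem : (t * z'.1 + c t * (partner c η θ u v 0 z').1,
          t * z'.2 + c t * (partner c η θ u v 0 z').2) ∈
            linPlane c z (partner c η α u v 0 z) := by
        rw [h]
        exact ⟨h0, t, rfl, rfl⟩
      obtain ⟨-, s, h1, h2⟩ := hmem
      simp only at h1 h2
      obtain ⟨e1, e2⟩ := eq_zero_of_smul_add_smul hδ (X := t * a + c t * b - s)
        (Y := t * e + c t * f - c s)
        (by linear_combination h1 - t * ha1 - c t * hb1)
        (by linear_combination h2 - t * ha2 - c t * hb2)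
      have e3 := congrArg c e1
      simp only [map_sub, map_add, map_mul, hcc, map_zero] at e3
      linear_combination e3 - e2
    · push Not at h0
      obtain ⟨e1, e2⟩ := eq_zero_of_smul_add_smul hδ (X := t * a + c t * b)
        (Y := t * e + c t * f)
        (by linear_combination h0.1 - t * ha1 - c t * hb1)
        (by linear_combination h0.2 - t * ha2 - c t * hb2)
      have e3 := congrArg c e1
      simp only [map_add, map_mul, hcc, map_zero] at e3
      linear_combination e3 - e2)
  obtain ⟨he, hf⟩ := hef
  have hcα : c α ≠ 0 := (map_ne_zero c).2 hα
  have hk1 := congrArg c ha1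
  have hk2 := congrArg c ha2
  simp only [partner, zero_mul, add_zero, map_mul, map_add, hcc] at hk1 hk2 hb1 hb2 hδ
  obtain ⟨e1, e2⟩ := eq_zero_of_smul_add_smul
    (w := (η * (c α * (c u * c z.1)), η * (c α * (c v * c z.2)))) hδ
    (X := c α * b - c α * c θ * α * c e) (Y := c α * f - c θ * c a)
    (by
      simp only
      linear_combination -c α * hb1 + c α * η * c θ * c u * hk1 +
        c α * c θ * α * c e * z.1 * c u * u * hη + c α * c θ * α * c e * z.1 * hu)
    (by
      simp only
      linear_combination -c α * hb2 + c α * η * c θ * c v * hk2 +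
        c α * c θ * α * c e * z.2 * c v * v * hη + c α * c θ * α * c e * z.2 * hv)
  have hce : c e = b := by rw [← sub_eq_zero.1 he, hcc]
  rw [hce] at e1
  rw [← sub_eq_zero.1 hf] at e2
  by_cases hb : b = 0
  · have ha : a ≠ 0 := by
      rintro rfl
      have he0 : e = 0 := by rw [← sub_eq_zero.1 he, hb, map_zero]
      simp [he0] at ha1 ha2
      simp [ha1, ha2] at hz'
    left
    have hca : c a ≠ 0 := (map_ne_zero c).2 ha
    refine c.injective (mul_left_cancel₀ hca ?_)
    linear_combination -e2
  · right
    refine mul_left_cancel₀ (mul_ne_zero hcα hb) ?_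
    linear_combination -e1

lemma smul_eq_of_fixedPlane_eq [Fintype F] (hq : 2 ≤ q) (hF : Fintype.card F = q ^ 2)
    (hc : ∀ x, c x = x ^ q) (hcc : ∀ x, c (c x) = x) {u v ρ u' v' d' : F}
    (hu : c u * u = 1) (hv : c v * v = 1)
    (h : fixedPlane c 1 u v 0 = fixedPlane c ρ u' v' d') :
    u = ρ * u' ∧ v = ρ * v' ∧ d' = 0 := by
  obtain ⟨x, hx0, hx⟩ := exists_conj_eq_mul hq hF hc hcc hu
  obtain ⟨y, hy0, hy⟩ := exists_conj_eq_mul hq hF hc hcc hv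
  have hx' : (x, 0) ∈ fixedPlane c ρ u' v' d' := by
    rw [← h]
    exact ⟨Or.inl hx0, by simp [hx], by simp⟩
  have hy' : (0, y) ∈ fixedPlane c ρ u' v' d' := by
    rw [← h]
    exact ⟨Or.inr hy0, by simp, by simp [hy]⟩
  obtain ⟨-, h1, -⟩ := hx'
  obtain ⟨-, h2, h3⟩ := hy'
  simp only [hx, hy, map_zero, mul_zero, add_zero, zero_add] at h1 h2 h3
  have e1 : u = ρ * u' := mul_right_cancel₀ hx0 (by linear_combination h1)
  refine ⟨e1, mul_right_cancel₀ hy0 (by linear_combination h3), ?_⟩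
  have hρ : ρ ≠ 0 := by
    rintro rfl
    simp [e1] at hu
  simpa [hρ, hy0] using h2.symm

/-- Outside norm `-1`, two members of an index set are not mutually inverse in norm. -/
lemma IsIndexSet.mul_ne_one {I : Set F} (hI : IsIndexSet q F I) {α β : F} (hα : α ∈ I)
    (hβ : β ∈ I) (hβ1 : β ^ (q + 1) ≠ -1) : α ^ (q + 1) * β ^ (q + 1) ≠ 1 := by
  obtain ⟨-, -, -, -, -, he, ho⟩ := hI
  intro h
  have hmem : β ^ (q + 1) ∈ normIm q F I ∩ Inv.inv '' normIm q F I :=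
    ⟨⟨β, hβ, rfl⟩, _, ⟨α, hα, rfl⟩, inv_eq_of_mul_eq_one_right h⟩
  rcases Nat.even_or_odd q with hq | hq
  · rw [he hq] at hmem
    exact hmem
  · rw [(ho hq).1] at hmem
    exact hβ1 hmem

/-- If the spread attached to `graphLine α u v 0` also arises from `graphLine α' u' v' d'`, the
parameters agree up to a scalar `ρ`, and `α'` is `ρ α` or its conjugate inverse. -/
lemma eq_or_mul_eq_one_of_switch_eq [Fintype F] (hq : 2 ≤ q) (hF : Fintype.card F = q ^ 2)
    (hc : ∀ x, c x = x ^ q) (hcc : ∀ x, c (c x) = x) (hη : c η * η = 1)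
    {α u v α' u' v' d' x y : F} (hα : α ≠ 0) (hα1 : c α * α ≠ 1) (hu : c u * u = 1)
    (hv : c v * v = 1) (hα1' : c α' * α' ≠ 1) (hu' : c u' * u' = 1) (hv' : c v' * v' = 1)
    (hy : y ≠ 0) (hcx : c x = u' * x + d' * y) (hcy : c y = v' * y)
    (h : (Sspread q F η (graphLine α u v 0) \ Rreg q F η (graphLine α u v 0)) ∪
        Ropp q F η (graphLine α u v 0) =
      (Sspread q F η (graphLine α' u' v' d') \ Rreg q F η (graphLine α' u' v' d')) ∪
        Ropp q F η (graphLine α' u' v' d')) :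
    ∃ ρ, c ρ * ρ = 1 ∧ u = ρ * u' ∧ v = ρ * v' ∧ (α' * c ρ = α ∨ c (α' * c ρ) * α = 1) := by
  have hq0 : q ≠ 0 := by omega
  have hη0 : η ≠ 0 := right_ne_zero_of_mul_eq_one hη
  have hv0 : v ≠ 0 := right_ne_zero_of_mul_eq_one hv
  obtain ⟨a, ha0, ha⟩ := exists_conj_eq_mul hq hF hc hcc hu'
  obtain ⟨k, hk0, hk⟩ := exists_conj_eq_mul hq hF hc hcc hv
  have hB : graphLine η u v 0 ∩ SigmaSet q F η ∈ Ropp q F η (graphLine α' u' v' d') := by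
    have hB' := h.subset (Or.inr (graphLine_inter_mem_Ropp hq hF hc hcc hη hα hα1 hu hv))
    refine hB'.resolve_left fun hS => ?_
    obtain ⟨-, z, -, hch⟩ := (mem_Sspread_iff hc hcc hq0 hη hα1' hu' hv').1 hS.1
    rw [chart_graphLine_inter hc hq0 hη0] at hch
    exact hk0 (linPlane_partner_ne_fixedPlane hq hF hc hcc hη hα1' hv' hch.symm
      (p := (0, k)) ⟨Or.inr hk0, by simp, by simp [hk]⟩)
  obtain ⟨ρ, hρ, -⟩ :=
    exists_chart_eq_of_mem_Ropp hc hcc hq0 hη hα1' hu' hv' hB ha0 hy ha hcx hcy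
  rw [chart_graphLine_inter hc hq0 hη0] at hρ
  obtain ⟨rfl, rfl, rfl⟩ := smul_eq_of_fixedPlane_eq hq hF hc hcc hu hv hρ
  have hρ1 : c ρ * ρ = 1 := by
    rw [map_mul] at hu
    linear_combination hu - c ρ * ρ * hu'
  refine ⟨ρ, hρ1, rfl, rfl, ?_⟩
  obtain ⟨s, hs⟩ := exists_conj_ne_mul hq hF hc (c (ρ * u') * (ρ * v'))
  have hδ : ((1, s) : F × F).1 * (partner c η α (ρ * u') (ρ * v') 0 (1, s)).2 -
      ((1, s) : F × F).2 * (partner c η α (ρ * u') (ρ * v') 0 (1, s)).1 ≠ 0 := by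
    intro h0
    refine hs (mul_left_cancel₀
      (mul_ne_zero (mul_ne_zero hη0 ((map_ne_zero c).2 hα)) ((map_ne_zero c).2 hv0)) ?_)
    simp only [partner, zero_mul, add_zero, map_mul, mul_one, one_mul] at h0 hv ⊢
    linear_combination h0 - η * c α * s * c ρ * c u' * hv
  obtain ⟨m, hmS, hm⟩ := exists_mem_Sspread hc hcc hq0 hη hα1 hu hv (d := 0) (z := (1, s))
    (Or.inl one_ne_zero)
  have hmD : m ∉ Dspread q F η := by
    intro hD
    obtain ⟨b, e, hbe, -, e1, e2⟩ := exists_of_chart_eq_linPlane_of_mem_Dspread hq hF hc hD hm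
    simp only [one_mul] at e1
    refine hδ ?_
    have hb : b ≠ 0 := by
      rintro rfl
      simp [e1] at hbe
    refine mul_left_cancel₀ hb ?_
    simp only
    linear_combination -e2 + (partner c η α (ρ * u') (ρ * v') 0 (1, s)).1 * e1
  have hm' : m ∈ Sspread q F η (graphLine α' u' v' 0) := by
    have hm' := h.subset (Or.inl ⟨hmS, fun hR => hmD hR.1⟩)
    refine (hm'.resolve_right fun hR => ?_).1
    obtain ⟨σ, hσ, p, hp, hp2⟩ :=
      exists_chart_eq_of_mem_Ropp hc hcc hq0 hη hα1' hu' hv' hR ha0 hy ha hcx hcy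
    rw [hσ] at hp
    exact hp2 (linPlane_partner_ne_fixedPlane hq hF hc hcc hη hα1 hv (hm.symm.trans hσ) hp)
  obtain ⟨-, z', hz', hch'⟩ := (mem_Sspread_iff hc hcc hq0 hη hα1' hu' hv').1 hm'
  have hpart : partner c η α' u' v' 0 z' = partner c η (α' * c ρ) (ρ * u') (ρ * v') 0 z' := by
    ext <;> simp only [partner, zero_mul, add_zero, map_mul, hcc]
    · linear_combination -(η * c α' * (c u' * c z'.1)) * hρ1
    · linear_combination -(η * c α' * c v' * c z'.2) * hρ1
  exact eq_or_conj_mul_eq_one_of_linPlane_partner_eq hq hF hc hcc hη hα hu hv hδ hz'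
    (by rw [← hm, hch', hpart])

end main

/-- Distinct good sets whose triples avoid norm `-1` yield distinct parallelisms. -/
theorem statement18 (q : ℕ) (hq : IsPrimePow q) (hq3 : 3 ≤ q) (F : Type) [Field F] [Fintype F]
    (hF : Fintype.card F = q ^ 2) (I : Set F) (hI : IsIndexSet q F I)
    (η : F) (hηU : η ^ (q + 1) = 1)
    (G G' : Finset (F × F × F))
    (hG : IsGoodSet q F I G) (hG' : IsGoodSet q F I G')
    (hGm1 : ∀ t ∈ G, t.1 ^ (q + 1) ≠ -1)
    (hG'm1 : ∀ t ∈ G', t.1 ^ (q + 1) ≠ -1)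
    (hne : G ≠ G') :
    ParP q F η G ≠ ParP q F η G' := by
  obtain ⟨c, hc, hcc⟩ := exists_conj hq hF
  have hq2 : 2 ≤ q := by omega
  have hη : c η * η = 1 := by rw [hc, ← pow_succ, hηU]
  have hη0 : η ≠ 0 := right_ne_zero_of_mul_eq_one hη
  have hgood : ∀ H : Finset (F × F × F), IsGoodSet q F I H → ∀ t ∈ H,
      t.1 ∈ I ∧ t.1 ≠ 0 ∧ c t.1 * t.1 ≠ 1 ∧ c t.2.1 * t.2.1 = 1 ∧ c t.2.2 * t.2.2 = 1 := by
    intro H hH t ht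
    obtain ⟨h1, h2, h3⟩ := hH.2.1 t ht
    refine ⟨h1, fun h0 => hI.1 (h0 ▸ h1), fun h => hI.2.2.2.1 ⟨t.1, h1, ?_⟩, ?_, ?_⟩
    · simp only [pow_succ, ← hc, h]
    · rw [hc, ← pow_succ]
      exact h2
    · rw [hc, ← pow_succ]
      exact h3
  intro hPar
  refine hne (Finset.eq_of_subset_of_card_le ?_ (by rw [hG.1, hG'.1]))
  rintro ⟨α, u, v⟩ ht
  obtain ⟨hαI, hα, hα1, hu, hv⟩ := hgood G hG _ ht
  simp only at hαI hα hα1 hu hv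
  have hmem : (Sspread q F η (graphLine α u v 0) \ Rreg q F η (graphLine α u v 0)) ∪
      Ropp q F η (graphLine α u v 0) ∈ ParP q F η G' := by
    rw [← hPar]
    exact Or.inl ⟨_, Set.mem_biUnion ht (graphLine_mem_pencil hq2 hF hc hcc hα hu hv), rfl⟩
  rcases hmem with ⟨ℓ, hℓ, hS⟩ | hS
  · obtain ⟨⟨α', u', v'⟩, ht', hℓ'⟩ := Set.mem_iUnion₂.1 hℓ
    obtain ⟨hαI', hα', hα1', hu', hv'⟩ := hgood G' hG' _ ht'
    simp only at hαI' hα' hα1' hu' hv' hℓ'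
    obtain ⟨d, rfl, x, y, hy, hcx, hcy⟩ := exists_eq_graphLine_of_mem_pencil hq2 hc hα' hℓ'
    obtain ⟨ρ, hρ, rfl, rfl, h | h⟩ := eq_or_mul_eq_one_of_switch_eq hq2 hF hc hcc hη hα hα1
      hu hv hα1' hu' hv' hy hcx hcy hS
    · have hαα' : α' = α := by
        refine hI.2.1 hαI' hαI ?_
        simp only [pow_succ, ← hc, ← h, map_mul, hcc]
        linear_combination -(c α' * α') * hρ
      subst hαα'
      have hcρ : c ρ = 1 := mul_left_cancel₀ hα' (by rw [h, mul_one])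
      have hρ1 : ρ = 1 := by rw [← hcc ρ, hcρ, map_one]
      simpa [hρ1] using ht'
    · refine absurd ?_ (hI.mul_ne_one hαI hαI' (hG'm1 _ ht'))
      have h' := congrArg c h
      simp only [map_mul, hcc, map_one] at h h'
      simp only [pow_succ, ← hc]
      linear_combination c α' * ρ * α * h' + h - c α' * c α * α' * α * hρ
  · have hB : graphLine η u v 0 ∩ SigmaSet q F η ∈ Dspread q F η := by
      rw [← Set.mem_singleton_iff.1 hS]
      exact Or.inr (graphLine_inter_mem_Ropp hq2 hF hc hcc hη hα hα1 hu hv)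
    obtain ⟨-, a, b, hab, hch⟩ := exists_chart_of_mem_Dspread hc (by omega) hB
    rw [chart_graphLine_inter hc (by omega) hη0] at hch
    obtain ⟨x, hx0, hx⟩ := exists_conj_eq_mul hq2 hF hc hcc hu
    obtain ⟨y, hy0, hy⟩ := exists_conj_eq_mul hq2 hF hc hcc hv
    obtain ⟨-, s, hs1, hs2⟩ := hch.subset (show (x, 0) ∈ fixedPlane c 1 u v 0 from
      ⟨Or.inl hx0, by simp [hx], by simp⟩)
    obtain ⟨-, r, hr1, hr2⟩ := hch.subset (show (0, y) ∈ fixedPlane c 1 u v 0 from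
      ⟨Or.inr hy0, by simp, by simp [hy]⟩)
    refine absurd ?_ (mul_ne_zero hx0 hy0)
    simp only at hs1 hs2 hr1 hr2
    linear_combination y * hs1 + s * a * hr2 - r * a * hs2
end

section
/- Let q ≥ 3 be a prime power, I an index set, η ∈ F_{q^2} with η^{q+1} = 1, and let 𝒫, 𝒫' be good sets. If ψ is a collineation of PG(3,q^2) such that ψ(Σ_η) = Σ_η and ψ maps Π_𝒫 to Π_{𝒫'} (i.e. { {ψ(m) : m ∈ S} : S ∈ Π_𝒫 } = Π_{𝒫'}), then ψ maps the spread D_η to itself and maps the line r_{U_1} ∩ Σ_η of Σ_η to itself. -/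
open Projectivization Classical

/-- `c` is the involutory automorphism `x ↦ xᑫ` of `F_{q²}`. -/
structure IsPowConj {F : Type} [Field F] (q : ℕ) (c : F →+* F) : Prop where
  pow_eq : ∀ x, x ^ q = c x
  invol : ∀ x, c (c x) = x

section FieldFacts

variable {F : Type} [Field F] {q : ℕ} {c : F →+* F}

theorem exists_isPowConj [Fintype F] (hq : IsPrimePow q) (hF : Fintype.card F = q ^ 2) :
    ∃ c : F →+* F, IsPowConj q c := by
  obtain ⟨p, k, hp, hk, rfl⟩ := (isPrimePow_nat_iff q).1 hq
  have : Fact p.Prime := ⟨hp⟩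
  have : CharP F p := charP_of_card_eq_prime_pow (f := k * 2) (by rw [hF, pow_mul])
  refine ⟨iterateFrobenius F p k, fun x => (iterateFrobenius_def p k x).symm, fun x => ?_⟩
  rw [iterateFrobenius_def, iterateFrobenius_def, ← pow_mul, ← sq, ← hF, FiniteField.pow_card]

theorem IsPowConj.exists_ne [Fintype F] (hc : IsPowConj q c) (hq3 : 3 ≤ q)
    (hF : Fintype.card F = q ^ 2) : ∃ z, c z ≠ z := by
  by_contra! h
  have h1 : Fintype.card F ≤ q := by
    have hne := FiniteField.X_pow_card_sub_X_ne_zero F (p := q) (by omega)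
    have hdeg := FiniteField.X_pow_card_sub_X_natDegree_eq F (p := q) (by omega)
    have := Polynomial.card_le_degree_of_subset_roots (Z := Finset.univ)
      (p := (Polynomial.X ^ q - Polynomial.X : Polynomial F)) (by
        intro x _
        rw [Polynomial.mem_roots hne]
        simp [hc.pow_eq, h])
    rw [hdeg] at this
    simpa using this
  nlinarith

theorem IsPowConj.ncard_fixed [Fintype F] (hc : IsPowConj q c) (hq3 : 3 ≤ q)
    (hF : Fintype.card F = q ^ 2) : {x | c x = x}.ncard = q := by
  have h0 : {x | c x = x} = insert 0
      ((fun u : Fˣ => (u : F)) '' ((powMonoidHom (q - 1) : Fˣ →* Fˣ).ker : Set Fˣ)) := by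
    ext x
    have key : ∀ u : Fˣ, (u ^ (q - 1) = 1 ↔ c (u : F) = u) := by
      intro u
      rw [← hc.pow_eq, Units.ext_iff]
      push_cast
      constructor
      · intro h
        rw [show q = q - 1 + 1 by omega, pow_succ, h, one_mul]
      · intro h
        have : (u : F) ^ (q - 1) * u = 1 * u := by
          rw [← pow_succ, show q - 1 + 1 = q by omega, h, one_mul]
        exact mul_right_cancel₀ u.ne_zero this
    simp only [Set.mem_ofPred_eq, Set.mem_insert_iff, Set.mem_image, SetLike.mem_coe,
      MonoidHom.mem_ker, powMonoidHom_apply, key]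
    constructor
    · intro h
      by_cases hx : x = 0
      · exact Or.inl hx
      · exact Or.inr ⟨Units.mk0 x hx, h, rfl⟩
    · rintro (rfl | ⟨u, hu, rfl⟩)
      · simp
      · exact hu
  have hk := IsCyclic.card_powMonoidHom_ker (G := Fˣ) (q - 1)
  have hcard : Nat.card Fˣ = (q + 1) * (q - 1) := by
    rw [Nat.card_units, Nat.card_eq_fintype_card, hF]
    have := Nat.sq_sub_sq q 1
    simpa using this
  rw [hcard, Nat.gcd_mul_left_left] at hk
  rw [h0, Set.ncard_insert_of_notMem (by simp), Set.ncard_image_of_injective _ Units.val_injective]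
  have : ((powMonoidHom (q - 1) : Fˣ →* Fˣ).ker : Set Fˣ).ncard = q - 1 := hk
  omega

theorem IsPowConj.exists_third [Fintype F] (hc : IsPowConj q c) (hq3 : 3 ≤ q)
    (hF : Fintype.card F = q ^ 2) : ∃ s, c s = s ∧ s ≠ 0 ∧ s ≠ 1 := by
  by_contra! h
  have h1 : {x | c x = x} ⊆ {0, 1} := by
    intro x hx
    by_cases h0 : x = 0
    · simp [h0]
    · simp [h x hx h0]
  have h2 := Set.ncard_le_ncard h1 (Set.toFinite _)
  rw [hc.ncard_fixed hq3 hF] at h2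
  have h3 := Set.ncard_pair (zero_ne_one (α := F))
  omega

/-- Hilbert's theorem 90 for the quadratic extension. -/
theorem IsPowConj.exists_eq_mul (hc : IsPowConj q c) (hne : ∃ z, c z ≠ z) {u : F}
    (hu : u * c u = 1) : ∃ x, x ≠ 0 ∧ c x = u * x := by
  obtain ⟨z, hz⟩ := hne
  have key : ∀ w, c (w + c u * c w) = u * (w + c u * c w) := by
    intro w
    simp only [map_add, map_mul, hc.invol]
    linear_combination -(c w) * hu
  by_cases h1 : (1 : F) + c u * c 1 = 0
  · refine ⟨z + c u * c z, fun h2 => hz ?_, key z⟩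
    simp only [map_one, mul_one] at h1
    linear_combination -h2 + c z * h1
  · exact ⟨_, h1, key 1⟩

theorem IsPowConj.exists_three_norm_one (hc : IsPowConj q c) (hne : ∃ z, c z ≠ z) :
    ∃ u : Fin 3 → F, Function.Injective u ∧ ∀ i, u i * c (u i) = 1 := by
  obtain ⟨z, hz⟩ := hne
  have hz0 : z ≠ 0 := by rintro rfl; simp at hz
  have hz1 : z + 1 ≠ 0 := by
    intro h
    have := eq_neg_of_add_eq_zero_left h
    rw [this] at hz
    simp at hz
  have hcz0 : c z ≠ 0 := (map_ne_zero c).2 hz0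
  have hcz1 : c z + 1 ≠ 0 := by simpa using (map_ne_zero c).2 hz1
  have h01 : (1 : F) ≠ c z / z := by
    intro h; rw [eq_div_iff hz0] at h; exact hz (by simpa using h.symm)
  have h02 : (1 : F) ≠ (c z + 1) / (z + 1) := by
    intro h; rw [eq_div_iff hz1] at h; exact hz (by linear_combination -h)
  have h12 : c z / z ≠ (c z + 1) / (z + 1) := by
    intro h; rw [div_eq_div_iff hz0 hz1] at h; exact hz (by linear_combination h)
  refine ⟨![1, c z / z, (c z + 1) / (z + 1)], ?_, ?_⟩
  · intro i j hij
    fin_cases i <;> fin_cases j <;> simp at hij ⊢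
    · exact h01 hij
    · exact h02 hij
    · exact h01 hij.symm
    · exact h12 hij
    · exact h02 hij.symm
    · exact h12 hij.symm
  · intro i
    fin_cases i
    · simp
    · simp only [Fin.mk_one, Matrix.cons_val_one, Matrix.cons_val_zero, map_div₀, hc.invol]
      field_simp
    · simp only [Fin.reduceFinMk, Matrix.cons_val, map_div₀, map_add, map_one, hc.invol]
      field_simp

theorem leading_eq_zero_of_three_roots {a b d : F} {x : Fin 3 → F} (hx : Function.Injective x)
    (h : ∀ i, a * x i ^ 2 + b * x i + d = 0) : a = 0 := by
  have n01 : x 0 - x 1 ≠ 0 := sub_ne_zero.2 (hx.ne (by decide))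
  have n02 : x 0 - x 2 ≠ 0 := sub_ne_zero.2 (hx.ne (by decide))
  have n12 : x 1 - x 2 ≠ 0 := sub_ne_zero.2 (hx.ne (by decide))
  have e1 : a * (x 0 + x 1) + b = 0 :=
    mul_left_cancel₀ n01 (by linear_combination h 0 - h 1)
  have e2 : a * (x 0 + x 2) + b = 0 :=
    mul_left_cancel₀ n02 (by linear_combination h 0 - h 2)
  exact mul_left_cancel₀ n12 (by linear_combination e1 - e2)

/-- `z` lies on the Apollonius circle with foci `m`, `c m` and ratio `α`. -/
def OnCircle (c : F →+* F) (α m z : F) : Prop :=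
  (z - m) * (c z - c m) = α * c α * ((z - c m) * (c z - m))

theorem OnCircle.symm {α m z : F} (h : OnCircle c α m z) : OnCircle c α z m := by
  unfold OnCircle at *
  linear_combination h

theorem IsPowConj.exists_three_onCircle (hc : IsPowConj q c) (hne : ∃ z, c z ≠ z) {α : F}
    (hα0 : α ≠ 0) (hα1 : α * c α ≠ 1) {z : F} (hz : c z ≠ z) :
    ∃ m : Fin 3 → F, Function.Injective m ∧ ∀ i, c (m i) ≠ m i ∧ OnCircle c α z (m i) := by
  obtain ⟨u, hu, hu1⟩ := hc.exists_three_norm_one hne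
  have hd : ∀ i, 1 - α * u i ≠ 0 := by
    intro i h
    have h' : α * u i = 1 := (sub_eq_zero.1 h).symm
    have h'' : c α * c (u i) = 1 := by rw [← map_mul, h', map_one]
    apply hα1
    linear_combination (-α * c α) * hu1 i + c α * c (u i) * h' + h''
  have hex : ∀ i, ∃ m, m - z = α * u i * (m - c z) := by
    intro i
    have := hd i
    refine ⟨(z - α * u i * c z) / (1 - α * u i), ?_⟩
    field_simp
    ring
  choose m hm using hex
  have hmc : ∀ i, m i - c z ≠ 0 := by
    intro i h
    have := hm i
    rw [h, mul_zero] at this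
    exact hz (by linear_combination this - h)
  refine ⟨m, ?_, fun i => ?_⟩
  · intro i j hij
    apply hu
    have h1 := hm i
    rw [hij, hm j] at h1
    exact (mul_left_cancel₀ hα0 (mul_right_cancel₀ (hij ▸ hmc i) h1)).symm
  · have hci : c (m i) - c z = c α * c (u i) * (c (m i) - z) := by
      simpa [hc.invol] using congrArg c (hm i)
    refine ⟨fun h => ?_, ?_⟩
    · rw [h] at hci
      have hmz : m i - z ≠ 0 := by
        rw [hm i]
        refine mul_ne_zero (mul_ne_zero hα0 ?_) (hmc i)
        intro h0
        simpa [h0] using hu1 i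
      apply hα1
      apply mul_right_cancel₀ hmz
      linear_combination -hm i - α * u i * hci - α * c α * (m i - z) * hu1 i
    · unfold OnCircle
      linear_combination (c (m i) - c z) * hm i + α * u i * (m i - c z) * hci
        + α * c α * (m i - c z) * (c (m i) - z) * hu1 i

theorem IsPowConj.eq_of_onCircle (hc : IsPowConj q c) {α : F} (hα1 : α * c α ≠ 1) {m m' : F}
    {z : Fin 3 → F} (hz : Function.Injective z) (h : ∀ i, OnCircle c α m (z i))
    (h' : ∀ i, OnCircle c α m' (z i)) :
    α * c α * (c m - c m') = m - m' ∧ m * c m = m' * c m' := by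
  have hk : c (α * c α) = α * c α := by rw [map_mul, hc.invol, mul_comm]
  generalize hK : α * c α = k at *
  unfold OnCircle at h h'
  rw [hK] at h h'
  set D := (m - m') - k * (c m - c m') with hD
  set E := (1 - k) * (m * c m - m' * c m') with hE
  have hcD : c D = (c m - c m') - k * (m - m') := by simp [hD, hk, hc.invol]
  have hlin : ∀ i, z i * c D + c (z i) * D = E := by
    intro i
    rw [hcD]
    linear_combination -(h i) + h' i
  have hD0 : D = 0 := by
    by_contra hD0
    have := leading_eq_zero_of_three_roots (a := -(1 - k) * c D)
      (b := (1 - k) * E - D * (c m - k * m) + c D * (m - k * c m))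
      (d := (1 - k) * m * c m * D - E * (m - k * c m)) hz (by
        intro i
        have h1 := hlin i
        linear_combination D * h i - ((1 - k) * z i - (m - k * c m)) * h1)
    rcases mul_eq_zero.1 this with h1 | h1
    · exact hα1 (by linear_combination h1)
    · exact hD0 ((map_eq_zero c).1 h1)
  have hE0 : E = 0 := by
    have := hlin 0
    rw [hD0] at this
    simpa using this.symm
  refine ⟨by linear_combination -hD0, ?_⟩
  rcases mul_eq_zero.1 hE0 with h1 | h1
  · exact absurd (by linear_combination -h1) hα1
  · exact sub_eq_zero.1 h1

/-- Three distinct foci do not define circles sharing three points. -/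
theorem IsPowConj.not_forall_onCircle (hc : IsPowConj q c) {α : F} (hα1 : α * c α ≠ 1)
    {m z : Fin 3 → F} (hm : Function.Injective m) (hz : Function.Injective z) :
    ¬ ∀ i j, OnCircle c α (m i) (z j) := by
  intro h
  have key := fun i => hc.eq_of_onCircle hα1 hz (h i) (h 0)
  have := leading_eq_zero_of_three_roots (a := 1) (b := α * c α * c (m 0) - m 0)
    (d := -(α * c α * (m 0 * c (m 0)))) hm (by
      intro i
      obtain ⟨h1, h2⟩ := key i
      linear_combination (-m i) * h1 + α * c α * h2)
  exact one_ne_zero this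

end FieldFacts

section BaerPoints

variable {F : Type} [Field F] {q : ℕ} {c : F →+* F}

/-- The vector `(x, y, α xᑫ, α yᑫ)` attached to `v = (x, y)`. -/
def hat (c : F →+* F) (α : F) (v : F × F) : Fin 4 → F :=
  ![v.1, v.2, α * c v.1, α * c v.2]

theorem hat_ne_zero (c : F →+* F) (α : F) {v : F × F} (hv : v ≠ 0) : hat c α v ≠ 0 := by
  intro h
  apply hv
  ext
  · simpa [hat] using congrFun h 0
  · simpa [hat] using congrFun h 1

theorem hat_add (α : F) (v w : F × F) : hat c α (v + w) = hat c α v + hat c α w := by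
  ext i
  fin_cases i <;> simp [hat, mul_add]

theorem hat_smul (α : F) {r : F} (hr : c r = r) (v : F × F) :
    hat c α (r • v) = r • hat c α v := by
  ext i
  fin_cases i <;> simp [hat, hr, mul_left_comm]

/-- The point of `Σ_α` attached to `v`. -/
def pt (c : F →+* F) (α : F) (v : F × F) (hv : v ≠ 0) : Pt F :=
  Projectivization.mk F (hat c α v) (hat_ne_zero c α hv)

/-- The set of points of `Σ_α` attached to the nonzero elements of `X`. -/
def ptSet (c : F →+* F) (α : F) (X : Set (F × F)) : Set (Pt F) :=
  {P | ∃ v, ∃ h : v ≠ 0, v ∈ X ∧ P = pt c α v h}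

/-- `X` is closed under multiplication by the elements of `F_q`. -/
def FixedClosed (c : F →+* F) (X : Set (F × F)) : Prop :=
  ∀ r v, c r = r → v ∈ X → r • v ∈ X

/-- `a` and `b` are linearly independent over `F`. -/
def Indep (a b : F × F) : Prop := ∀ x y : F, x • a + y • b = 0 → x = 0 ∧ y = 0

theorem Indep.ne_zero_left {a b : F × F} (h : Indep a b) : a ≠ 0 := by
  rintro rfl
  exact one_ne_zero (h 1 0 (by simp)).1

theorem Indep.ne_zero_right {a b : F × F} (h : Indep a b) : b ≠ 0 := by
  rintro rfl
  exact one_ne_zero (h 0 1 (by simp)).2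

theorem Indep.eq {a b : F × F} (h : Indep a b) {x y x' y' : F}
    (he : x • a + y • b = x' • a + y' • b) : x = x' ∧ y = y' := by
  have := h (x - x') (y - y') (by
    rw [sub_smul, sub_smul]
    linear_combination (exp := 1) he)
  exact ⟨sub_eq_zero.1 this.1, sub_eq_zero.1 this.2⟩

theorem mem_SigmaSet (hc : IsPowConj q c) {α : F} {P : Pt F} :
    P ∈ SigmaSet q F α ↔ ∃ v, ∃ h : v ≠ 0, P = pt c α v h := by
  constructor
  · rintro ⟨x, y, h, rfl⟩
    refine ⟨(x, y), ?_, ?_⟩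
    · intro h0
      obtain ⟨rfl, rfl⟩ := Prod.mk.inj h0
      apply h
      ext i
      fin_cases i <;> simp [hc.pow_eq]
    · simp [pt, hat, hc.pow_eq]
  · rintro ⟨v, h, rfl⟩
    have := hat_ne_zero c α h
    refine ⟨v.1, v.2, ?_, ?_⟩
    · simpa [hat, hc.pow_eq] using this
    · simp [pt, hat, hc.pow_eq]

theorem pt_eq_pt_iff {α : F} (hα : α ≠ 0) {v w : F × F} {hv : v ≠ 0}
    {hw : w ≠ 0} : pt c α v hv = pt c α w hw ↔ ∃ r, c r = r ∧ v = r • w := by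
  rw [pt, pt, Projectivization.mk_eq_mk_iff']
  constructor
  · rintro ⟨r, hr⟩
    have h0 : r * w.1 = v.1 := by simpa [hat] using congrFun hr 0
    have h1 : r * w.2 = v.2 := by simpa [hat] using congrFun hr 1
    have h2 : r * (α * c w.1) = α * c v.1 := by simpa [hat] using congrFun hr 2
    have h3 : r * (α * c w.2) = α * c v.2 := by simpa [hat] using congrFun hr 3
    have hvw : v = r • w := by ext <;> simp [h0, h1]
    refine ⟨r, ?_, hvw⟩
    rw [← h0, map_mul] at h2
    rw [← h1, map_mul] at h3
    by_contra hne
    have hd : α * (r - c r) ≠ 0 := mul_ne_zero hα (sub_ne_zero.2 (Ne.symm hne))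
    apply hw
    ext
    · exact (map_eq_zero c).1 (mul_left_cancel₀ hd (by linear_combination h2))
    · exact (map_eq_zero c).1 (mul_left_cancel₀ hd (by linear_combination h3))
  · rintro ⟨r, hr, rfl⟩
    exact ⟨r, (hat_smul α hr w).symm⟩

theorem mem_lineThrough_mk {a b w : Fin 4 → F} (ha : a ≠ 0) (hb : b ≠ 0) (hw : w ≠ 0) :
    Projectivization.mk F w hw ∈
      lineThrough F (Projectivization.mk F a ha) (Projectivization.mk F b hb) ↔
    ∃ x y : F, x • a + y • b = w := by
  simp only [lineThrough, Set.mem_ofPred_eq, Projectivization.submodule_mk,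
    Submodule.span_singleton_le_iff_mem, ← Submodule.span_union, Set.singleton_union,
    Submodule.mem_span_pair]

theorem hat_combination (hc : IsPowConj q c) {α : F} (hα : α ≠ 0) {a b v : F × F}
    (hab : Indep a b) {x y : F} (h : x • hat c α a + y • hat c α b = hat c α v) :
    c x = x ∧ c y = y ∧ v = x • a + y • b := by
  have h0 : x * a.1 + y * b.1 = v.1 := by simpa [hat] using congrFun h 0
  have h1 : x * a.2 + y * b.2 = v.2 := by simpa [hat] using congrFun h 1
  have h2 : x * (α * c a.1) + y * (α * c b.1) = α * c v.1 := by simpa [hat] using congrFun h 2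
  have h3 : x * (α * c a.2) + y * (α * c b.2) = α * c v.2 := by simpa [hat] using congrFun h 3
  have e2 : x * c a.1 + y * c b.1 = c v.1 := mul_left_cancel₀ hα (by linear_combination h2)
  have e3 : x * c a.2 + y * c b.2 = c v.2 := mul_left_cancel₀ hα (by linear_combination h3)
  have f2 := congrArg c e2
  have f3 := congrArg c e3
  simp only [map_add, map_mul, hc.invol] at f2 f3
  have hv : v = x • a + y • b := by ext <;> simp [h0, h1]
  have := hab.eq (x := c x) (y := c y) (x' := x) (y' := y) (by
    ext
    · simp only [Prod.fst_add, Prod.smul_fst, smul_eq_mul, f2, h0]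
    · simp only [Prod.snd_add, Prod.smul_snd, smul_eq_mul, f3, h1])
  exact ⟨this.1, this.2, hv⟩

theorem pt_mem_lineThrough_iff (hc : IsPowConj q c) {α : F} (hα : α ≠ 0) {a b v : F × F}
    (hab : Indep a b) {ha : a ≠ 0} {hb : b ≠ 0} {hv : v ≠ 0} :
    pt c α v hv ∈ lineThrough F (pt c α a ha) (pt c α b hb) ↔
      ∃ x y, c x = x ∧ c y = y ∧ v = x • a + y • b := by
  rw [pt, pt, pt, mem_lineThrough_mk]
  constructor
  · rintro ⟨x, y, h⟩
    exact ⟨x, y, hat_combination hc hα hab h⟩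
  · rintro ⟨x, y, hx, hy, rfl⟩
    exact ⟨x, y, by rw [hat_add, hat_smul α hx, hat_smul α hy]⟩

theorem pt_mem_ptSet {α : F} (hα : α ≠ 0) {X : Set (F × F)}
    (hX : FixedClosed c X) {v : F × F} {hv : v ≠ 0} : pt c α v hv ∈ ptSet c α X ↔ v ∈ X := by
  constructor
  · rintro ⟨w, hw, hwX, h⟩
    obtain ⟨r, hr, rfl⟩ := (pt_eq_pt_iff hα).1 h
    exact hX r w hr hwX
  · exact fun h => ⟨v, hv, h, rfl⟩

theorem ptSet_inter_nonempty {α : F} (hα : α ≠ 0) {X Y : Set (F × F)}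
    (hY : FixedClosed c Y) :
    (ptSet c α X ∩ ptSet c α Y).Nonempty ↔ ∃ v, v ≠ 0 ∧ v ∈ X ∧ v ∈ Y := by
  constructor
  · rintro ⟨P, ⟨v, hv, hvX, rfl⟩, hP⟩
    exact ⟨v, hv, hvX, (pt_mem_ptSet hα hY).1 hP⟩
  · rintro ⟨v, hv, hvX, hvY⟩
    exact ⟨pt c α v hv, ⟨v, hv, hvX, rfl⟩, ⟨v, hv, hvY, rfl⟩⟩

theorem inter_SigmaSet_eq_ptSet (hc : IsPowConj q c) {α : F} (s : Set (Pt F)) :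
    s ∩ SigmaSet q F α = ptSet c α {v | ∀ h : v ≠ 0, pt c α v h ∈ s} := by
  ext P
  constructor
  · rintro ⟨hs, hP⟩
    obtain ⟨v, hv, rfl⟩ := (mem_SigmaSet hc).1 hP
    exact ⟨v, hv, fun _ => hs, rfl⟩
  · rintro ⟨v, hv, hs, rfl⟩
    exact ⟨hs hv, (mem_SigmaSet hc).2 ⟨v, hv, rfl⟩⟩

theorem ncard_ptSet_span [Fintype F] {α : F} (hα : α ≠ 0)
    (hcard : {x | c x = x}.ncard = q) {a b : F × F} (hab : Indep a b) :
    (ptSet c α {v | ∃ x y, c x = x ∧ c y = y ∧ v = x • a + y • b}).ncard = q + 1 := by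
  have hne : ∀ s : F, s • a + b ≠ 0 := by
    intro s h
    exact one_ne_zero (hab s 1 (by simpa using h)).2
  have hset : ptSet c α {v | ∃ x y, c x = x ∧ c y = y ∧ v = x • a + y • b} =
      insert (pt c α a hab.ne_zero_left)
        ((fun s => pt c α (s • a + b) (hne s)) '' {x | c x = x}) := by
    ext P
    constructor
    · rintro ⟨v, hv, ⟨x, y, hx, hy, rfl⟩, rfl⟩
      by_cases h0 : y = 0
      · left
        rw [pt_eq_pt_iff hα]
        exact ⟨x, hx, by simp [h0]⟩
      · right
        refine ⟨x / y, by simp [hx, hy], ?_⟩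
        simp only
        rw [pt_eq_pt_iff hα]
        refine ⟨y⁻¹, by simp [hy], ?_⟩
        rw [smul_add, smul_smul, smul_smul, inv_mul_cancel₀ h0, one_smul, div_eq_inv_mul]
    · rintro (rfl | ⟨s, hs, rfl⟩)
      · exact ⟨a, _, ⟨1, 0, by simp, by simp, by simp⟩, rfl⟩
      · exact ⟨_, hne s, ⟨s, 1, hs, by simp, by simp⟩, rfl⟩
  rw [hset, Set.ncard_insert_of_notMem, Set.ncard_image_of_injective, hcard]
  · intro s s' h
    obtain ⟨r, hr, h⟩ := (pt_eq_pt_iff hα).1 h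
    have := hab.eq (x := s) (y := 1) (x' := r * s') (y' := r) (by
      rw [one_smul, h, smul_add, smul_smul])
    rw [← this.2, one_mul] at this
    exact this.1
  · rintro ⟨s, hs, h⟩
    obtain ⟨r, hr, h⟩ := (pt_eq_pt_iff hα).1 h
    have := hab.eq (x := s) (y := 1) (x' := r) (y' := 0) (by
      rw [one_smul, h, zero_smul, add_zero])
    exact one_ne_zero this.2

end BaerPoints

section DesarguesianSpread

variable {F : Type} [Field F] {q : ℕ} {c : F →+* F}

/-- The one-dimensional `F`-subspace generated by `a`. -/
def ray (a : F × F) : Set (F × F) := Set.range fun k : F => k • a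

theorem fixedClosed_ray (c : F →+* F) (a : F × F) : FixedClosed c (ray a) := by
  rintro r _ - ⟨k, rfl⟩
  exact ⟨r * k, by simp [smul_smul]⟩

theorem mem_ray_self (a : F × F) : a ∈ ray a := ⟨1, by simp⟩

theorem ray_eq_of_mem {a v : F × F} (hv : v ≠ 0) (h : v ∈ ray a) : ray a = ray v := by
  obtain ⟨k, rfl⟩ := h
  have hk : k ≠ 0 := by rintro rfl; simp at hv
  ext w
  constructor
  · rintro ⟨l, rfl⟩
    exact ⟨l / k, by simp [smul_smul, hk]⟩
  · rintro ⟨l, rfl⟩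
    exact ⟨l * k, by simp [smul_smul]⟩

theorem indep_of_ray_ne {a b : F × F} (ha : a ≠ 0) (hb : b ≠ 0) (h : ray a ≠ ray b) :
    Indep a b := by
  intro x y hxy
  have hx : x = 0 := by
    by_contra hx
    apply h
    symm
    apply ray_eq_of_mem ha
    refine ⟨-(y / x), ?_⟩
    apply smul_right_injective _ hx
    simp only [smul_smul, neg_smul, smul_neg]
    rw [mul_div_cancel₀ _ hx]
    exact neg_eq_of_add_eq_zero_left hxy
  refine ⟨hx, ?_⟩
  rw [hx, zero_smul, zero_add] at hxy
  exact (smul_eq_zero.1 hxy).resolve_right hb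

theorem ray_ne_of_indep {a b : F × F} (h : Indep a b) : ray a ≠ ray b := by
  intro he
  obtain ⟨k, hk⟩ : a ∈ ray b := he ▸ mem_ray_self a
  have := h 1 (-k) (by simp [← hk])
  exact one_ne_zero this.1

theorem tau_mk_s19 (hc : IsPowConj q c) {η : F} (hη : η ^ (q + 1) = 1) {x : Fin 4 → F} (hx : x ≠ 0)
    (hx' : ![c (x 2), c (x 3), c (x 0), c (x 1)] ≠ 0) :
    tau q F η (Projectivization.mk F x hx) = Projectivization.mk F _ hx' := by
  obtain ⟨k, hk⟩ := Projectivization.exists_smul_eq_mk_rep F x hx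
  have h : tauFun q F η (Projectivization.mk F x hx).rep =
      c k • ![c (x 2), c (x 3), c (x 0), c (x 1)] := by
    rw [← hk]
    ext i
    fin_cases i <;> simp [tauFun, hη, hc.pow_eq, Units.smul_def]
  have hne : tauFun q F η (Projectivization.mk F x hx).rep ≠ 0 := by
    rw [h]
    exact smul_ne_zero ((map_ne_zero c).2 k.ne_zero) hx'
  rw [tau, dif_pos hne, Projectivization.mk_eq_mk_iff']
  exact ⟨c k, h.symm⟩

theorem conj_swap_ne_zero (c : F →+* F) {x : Fin 4 → F} (hx : x ≠ 0) :
    ![c (x 2), c (x 3), c (x 0), c (x 1)] ≠ 0 := by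
  intro h
  apply hx
  ext i
  fin_cases i
  · simpa using congrFun h 2
  · simpa using congrFun h 3
  · simpa using congrFun h 0
  · simpa using congrFun h 1

theorem rLine_inter_SigmaSet (hc : IsPowConj q c) {a : F × F} {x : Fin 4 → F} (hx : x ≠ 0)
    (hxa : x = ![a.1, a.2, 0, 0]) :
    rLine q F (Projectivization.mk F x hx) ∩ SigmaSet q F 1 = ptSet c 1 (ray a) := by
  have ha : a ≠ 0 := by
    rintro rfl
    apply hx
    rw [hxa]
    ext i
    fin_cases i <;> simp
  rw [inter_SigmaSet_eq_ptSet hc, rLine, tau_mk_s19 hc (one_pow _) hx (conj_swap_ne_zero c hx)]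
  congr 1
  ext v
  constructor
  · intro h
    by_cases hv : v = 0
    · exact ⟨0, by simp [hv]⟩
    · obtain ⟨k, l, hkl⟩ := (mem_lineThrough_mk _ _ _).1 (h hv)
      subst hxa
      refine ⟨k, ?_⟩
      ext
      · simpa [hat] using congrFun hkl 0
      · simpa [hat] using congrFun hkl 1
  · rintro ⟨k, rfl⟩ hv
    rw [pt, mem_lineThrough_mk]
    refine ⟨k, c k, ?_⟩
    subst hxa
    ext i
    fin_cases i <;> simp [hat]

theorem mem_Dspread (hc : IsPowConj q c) {m : Set (Pt F)} :
    m ∈ Dspread q F 1 ↔ ∃ a, a ≠ 0 ∧ m = ptSet c 1 (ray a) := by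
  constructor
  · rintro ⟨P, ⟨h2, h3⟩, rfl⟩
    have hP := P.rep_nonzero
    refine ⟨(P.rep 0, P.rep 1), ?_, ?_⟩
    · intro h
      apply hP
      ext i
      fin_cases i
      · exact (Prod.mk.inj h).1
      · exact (Prod.mk.inj h).2
      · exact h2
      · exact h3
    · rw [← rLine_inter_SigmaSet hc hP, Projectivization.mk_rep]
      ext i
      fin_cases i <;> simp [h2, h3]
  · rintro ⟨a, ha, rfl⟩
    have hx : ![a.1, a.2, 0, 0] ≠ 0 := by
      intro h
      apply ha
      ext
      · simpa using congrFun h 0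
      · simpa using congrFun h 1
    refine ⟨Projectivization.mk F _ hx, ?_, (rLine_inter_SigmaSet hc hx rfl).symm⟩
    obtain ⟨k, hk⟩ := Projectivization.exists_smul_eq_mk_rep F _ hx
    constructor <;> rw [← hk] <;> simp

theorem rU1_inter_SigmaSet (hc : IsPowConj q c) :
    rU1 F ∩ SigmaSet q F 1 = ptSet c 1 (ray (1, 0)) := by
  rw [inter_SigmaSet_eq_ptSet hc]
  congr 1
  ext v
  constructor
  · intro h
    refine ⟨v.1, ?_⟩
    by_cases hv : v = 0
    · simp [hv]
    · obtain ⟨h1, -⟩ := h hv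
      obtain ⟨k, hk⟩ := Projectivization.exists_smul_eq_mk_rep F _ (hat_ne_zero c 1 hv)
      rw [pt, ← hk] at h1
      have : v.2 = 0 := by simpa [hat, Units.smul_def] using h1
      ext <;> simp [this]
  · rintro ⟨k, rfl⟩ hv
    obtain ⟨l, hl⟩ := Projectivization.exists_smul_eq_mk_rep F _ (hat_ne_zero c 1 hv)
    rw [pt]
    constructor <;> rw [← hl] <;> simp [hat]

/-- Two lines meeting three common elements of `S` meet the same elements of `S`. -/
def HasReguli (S : Set (Set (Pt F))) : Prop :=
  ∀ m₁ ∈ S, ∀ m₂ ∈ S, ∀ m₃ ∈ S, ∀ m ∈ S, m₁ ≠ m₂ → m₁ ≠ m₃ → m₂ ≠ m₃ →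
    ∀ P₁ ∈ m₁, ∀ P₂ ∈ m₂, ∀ P₃ ∈ m₃, ∀ P ∈ m, ∀ Q₁ ∈ m₁, ∀ Q₂ ∈ m₂, ∀ Q₃ ∈ m₃,
      P₃ ∈ lineThrough F P₁ P₂ → Q₃ ∈ lineThrough F Q₁ Q₂ → P ∈ lineThrough F P₁ P₂ →
        ∃ Q ∈ m, Q ∈ lineThrough F Q₁ Q₂

theorem hasReguli_Dspread (hc : IsPowConj q c) : HasReguli (Dspread q F 1) := by
  intro m₁ hm₁ m₂ hm₂ m₃ hm₃ m hm h12 h13 h23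
  rw [mem_Dspread hc] at hm₁ hm₂ hm₃ hm
  obtain ⟨a₁, -, rfl⟩ := hm₁
  obtain ⟨a₂, -, rfl⟩ := hm₂
  obtain ⟨a₃, -, rfl⟩ := hm₃
  obtain ⟨a, -, rfl⟩ := hm
  rintro _ ⟨v₁, hv₁, h₁, rfl⟩ _ ⟨v₂, hv₂, h₂, rfl⟩ _ ⟨v₃, hv₃, h₃, rfl⟩ _ ⟨v, hv, h, rfl⟩
  rw [ray_eq_of_mem hv₁ h₁] at h12 h13 ⊢
  rw [ray_eq_of_mem hv₂ h₂] at h12 h23 ⊢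
  rw [ray_eq_of_mem hv₃ h₃] at h13 h23 ⊢
  rw [ray_eq_of_mem hv h]
  rintro _ ⟨w₁, hw₁, h₁', rfl⟩ _ ⟨w₂, hw₂, h₂', rfl⟩ _ ⟨w₃, hw₃, h₃', rfl⟩ hl hl' hlv
  have hind := indep_of_ray_ne hv₁ hv₂ (fun h => h12 (by rw [h]))
  have hind' : Indep w₁ w₂ := indep_of_ray_ne hw₁ hw₂ (by
    rw [← ray_eq_of_mem hw₁ h₁', ← ray_eq_of_mem hw₂ h₂']
    exact fun h => h12 (by rw [h]))
  obtain ⟨k₁, rfl⟩ := h₁'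
  obtain ⟨k₂, rfl⟩ := h₂'
  obtain ⟨k₃, rfl⟩ := h₃'
  simp only at *
  rw [pt_mem_lineThrough_iff hc one_ne_zero hind] at hl hlv
  rw [pt_mem_lineThrough_iff hc one_ne_zero hind'] at hl'
  obtain ⟨x, y, hx, hy, rfl⟩ := hl
  obtain ⟨z, w, hz, hw, rfl⟩ := hlv
  obtain ⟨x', y', hx', hy', he⟩ := hl'
  have hk₃ : k₃ ≠ 0 := by rintro rfl; simp at hw₃
  rw [smul_smul, smul_smul, smul_add, smul_smul, smul_smul] at he
  obtain ⟨ex, ey⟩ := hind.eq he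
  have hx0 : x ≠ 0 := by
    rintro rfl
    apply h23
    rw [ray_eq_of_mem (a := v₂) hv₃ ⟨y, by simp⟩]
  have hy0 : y ≠ 0 := by
    rintro rfl
    apply h13
    rw [ray_eq_of_mem (a := v₁) hv₃ ⟨x, by simp⟩]
  refine ⟨pt c 1 (k₃ • (z • v₁ + w • v₂)) (smul_ne_zero hk₃ hv), ⟨_, _, ⟨k₃, rfl⟩, rfl⟩, ?_⟩
  rw [pt_mem_lineThrough_iff hc one_ne_zero hind']
  refine ⟨z * x' / x, w * y' / y, by simp [hx, hx', hz], by simp [hy, hy', hw], ?_⟩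
  rw [smul_smul, smul_smul, smul_add, smul_smul, smul_smul]
  congr 2
  · field_simp
    linear_combination z * ex
  · field_simp
    linear_combination w * ey

end DesarguesianSpread

section BaerLines

variable {F : Type} [Field F] {q : ℕ} {c : F →+* F}

theorem Indep.smul {e f : F × F} (h : Indep e f) {k : F} (hk : k ≠ 0) :
    Indep (k • e) (k • f) := by
  intro x y hxy
  rw [smul_smul, smul_smul] at hxy
  obtain ⟨h1, h2⟩ := h _ _ hxy
  exact ⟨(mul_eq_zero.1 h1).resolve_right hk, (mul_eq_zero.1 h2).resolve_right hk⟩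

theorem isLine_lineThrough {P Q : Pt F} (h : P ≠ Q) : isLine F (lineThrough F P Q) := by
  refine ⟨P.submodule ⊔ Q.submodule, ?_, rfl⟩
  have hli := Projectivization.linearIndependent_pair_iff_ne.2 h
  have := finrank_span_eq_card hli
  rwa [Matrix.range_cons_cons_empty, Submodule.span_insert, ← Projectivization.submodule_eq,
    ← Projectivization.submodule_eq, Fintype.card_fin] at this

theorem isLine.eq_lineThrough {s : Set (Pt F)} (hs : isLine F s) {P Q : Pt F} (hP : P ∈ s)
    (hQ : Q ∈ s) (h : P ≠ Q) : s = lineThrough F P Q := by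
  obtain ⟨W, hW, rfl⟩ := hs
  have hle : P.submodule ⊔ Q.submodule ≤ W := sup_le hP hQ
  have hli := Projectivization.linearIndependent_pair_iff_ne.2 h
  have := finrank_span_eq_card hli
  rw [Matrix.range_cons_cons_empty, Submodule.span_insert, ← Projectivization.submodule_eq,
    ← Projectivization.submodule_eq, Fintype.card_fin] at this
  have he := Submodule.eq_of_le_of_finrank_eq hle (by rw [this, hW])
  rw [lineThrough, he]

theorem pt_ne_pt {α : F} (hα : α ≠ 0) {a b : F × F} (hab : Indep a b) :
    pt c α a hab.ne_zero_left ≠ pt c α b hab.ne_zero_right := by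
  intro h
  obtain ⟨r, -, h⟩ := (pt_eq_pt_iff hα).1 h
  exact one_ne_zero (hab 1 (-r) (by simp [h])).1

/-- The line of `PG(3, q²)` through the points of `Σ_α` attached to `a` and `b`. -/
def baerLine (c : F →+* F) (α : F) {a b : F × F} (hab : Indep a b) : Set (Pt F) :=
  lineThrough F (pt c α a hab.ne_zero_left) (pt c α b hab.ne_zero_right)

theorem baerLine_inter_SigmaSet (hc : IsPowConj q c) {α : F} (hα : α ≠ 0) {a b : F × F}
    (hab : Indep a b) : baerLine c α hab ∩ SigmaSet q F α =
      ptSet c α {v | ∃ x y, c x = x ∧ c y = y ∧ v = x • a + y • b} := by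
  rw [inter_SigmaSet_eq_ptSet hc]
  congr 1
  ext v
  constructor
  · intro h
    by_cases hv : v = 0
    · exact ⟨0, 0, by simp, by simp, by simp [hv]⟩
    · exact (pt_mem_lineThrough_iff hc hα hab).1 (h hv)
  · exact fun h hv => (pt_mem_lineThrough_iff hc hα hab).2 h

theorem ncard_baerLine [Fintype F] (hc : IsPowConj q c) {α : F} (hα : α ≠ 0)
    (hcard : {x | c x = x}.ncard = q) {a b : F × F} (hab : Indep a b) :
    (baerLine c α hab ∩ SigmaSet q F α).ncard = q + 1 := by
  rw [baerLine_inter_SigmaSet hc hα hab, ncard_ptSet_span hα hcard hab]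

theorem mk_mem_baerLine {α : F} {a b : F × F} (hab : Indep a b) {w : Fin 4 → F} (hw : w ≠ 0) :
    Projectivization.mk F w hw ∈ baerLine c α hab ↔
      ∃ x y : F, x • hat c α a + y • hat c α b = w :=
  mem_lineThrough_mk _ _ _

theorem indep_triangular {x b y : F} (hx : x ≠ 0) (hy : y ≠ 0) : Indep (x, 0) (b, y) := by
  intro s t h
  have h2 : t * y = 0 := by simpa using congrArg Prod.snd h
  have ht := (mul_eq_zero.1 h2).resolve_right hy
  have h1 : s * x + t * b = 0 := by simpa using congrArg Prod.fst h
  rw [ht, zero_mul, add_zero] at h1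
  exact ⟨(mul_eq_zero.1 h1).resolve_right hx, ht⟩

theorem Ppt_eq_pt {α u x : F} (hx : x ≠ 0) (hxu : c x = u * x) {hx' : ((x, 0) : F × F) ≠ 0} :
    Ppt F α u = pt c α (x, 0) hx' := by
  rw [Ppt, pt, Projectivization.mk_eq_mk_iff']
  refine ⟨x⁻¹, ?_⟩
  ext i
  fin_cases i
  · simp [hat, hx]
  · simp [hat]
  · simp [hat, hxu]
    field_simp
  · simp [hat]

theorem exists_eq_baerLine_of_mem_pencil (hc : IsPowConj q c) (hq : 0 < q)
    (hne : ∃ z, c z ≠ z) {α u v : F} (hα : α ≠ 0) (hu : u * c u = 1) {ℓ : Set (Pt F)}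
    (hℓ : ℓ ∈ pencil q F α u v) (hr : ℓ ≠ rU1 F) :
    ∃ x b y, ∃ hx : x ≠ 0, ∃ hy : y ≠ 0,
      ℓ = baerLine c α (indep_triangular (b := b) hx hy) := by
  obtain ⟨hline, hP, -, hcard⟩ := hℓ
  obtain ⟨x, hx, hxu⟩ := hc.exists_eq_mul hne hu
  have hx' : ((x, 0) : F × F) ≠ 0 := fun h => hx (Prod.mk.inj h).1
  rw [Ppt_eq_pt hx hxu (hx' := hx')] at hP
  obtain ⟨Q, ⟨hQℓ, hQ⟩, hQP⟩ := Set.exists_ne_of_one_lt_ncard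
    (show 1 < (ℓ ∩ SigmaSet q F α).ncard by omega) (pt c α (x, 0) hx')
  obtain ⟨⟨b, y⟩, hby, rfl⟩ := (mem_SigmaSet hc).1 hQ
  have hℓ := hline.eq_lineThrough hP hQℓ hQP.symm
  refine ⟨x, b, y, hx, ?_, hℓ⟩
  rintro rfl
  apply hr
  have hd : α * (x * c b - c x * b) ≠ 0 := by
    refine mul_ne_zero hα fun h => hQP ?_
    rw [pt_eq_pt_iff hα]
    refine ⟨b / x, ?_, ?_⟩
    · rw [map_div₀, div_eq_div_iff ((map_ne_zero c).2 hx) hx]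
      linear_combination h
    · ext <;> simp [hx]
  rw [hℓ]
  ext P
  obtain ⟨w, hw, rfl⟩ : ∃ w, ∃ hw : w ≠ 0, P = Projectivization.mk F w hw :=
    ⟨P.rep, P.rep_nonzero, P.mk_rep.symm⟩
  have hmem : Projectivization.mk F w hw ∈ rU1 F ↔ w 1 = 0 ∧ w 3 = 0 := by
    obtain ⟨k, hk⟩ := Projectivization.exists_smul_eq_mk_rep F w hw
    simp [rU1, ← hk, Units.smul_def]
  rw [hmem, pt, pt, mem_lineThrough_mk]
  constructor
  · rintro ⟨s, t, rfl⟩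
    simp [hat]
  · rintro ⟨h1, h3⟩
    obtain ⟨D, hD⟩ : ∃ D, α * (x * c b - c x * b) * D = 1 := ⟨_, mul_inv_cancel₀ hd⟩
    refine ⟨(w 0 * (α * c b) - w 2 * b) * D, (x * w 2 - α * c x * w 0) * D, ?_⟩
    ext i
    fin_cases i
    · simp [hat]
      linear_combination w 0 * hD
    · simp [hat, h1]
    · simp [hat]
      linear_combination w 2 * hD
    · simp [hat, h3]

theorem baerLine_mem_pencil [Fintype F] (hc : IsPowConj q c)
    (hcard : {x | c x = x}.ncard = q) {α u v : F} (hα : α ≠ 0) {x b y : F} (hx : x ≠ 0)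
    (hy : y ≠ 0) (hxu : c x = u * x) (hyv : c y = v * y) :
    baerLine c α (indep_triangular (b := b) hx hy) ∈ pencil q F α u v \ {rU1 F} := by
  refine ⟨⟨isLine_lineThrough (pt_ne_pt hα (indep_triangular hx hy)), ?_, ?_,
    ncard_baerLine hc hα hcard _⟩, ?_⟩
  · rw [Ppt_eq_pt hx hxu (hx' := (indep_triangular (b := b) hx hy).ne_zero_left)]
    exact (mk_mem_baerLine _ _).2 ⟨1, 0, by simp⟩
  · intro P hP
    rw [← P.mk_rep, mk_mem_baerLine] at hP
    obtain ⟨s, t, h⟩ := hP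
    change P.rep 3 = _ * P.rep 1
    rw [← h]
    simp [hat, hyv]
    ring
  · intro h
    have hmem : pt c α (b, y) (indep_triangular (b := b) hx hy).ne_zero_right ∈ rU1 F := by
      rw [← Set.mem_singleton_iff.1 h]
      exact (mk_mem_baerLine _ _).2 ⟨0, 1, by simp⟩
    obtain ⟨h1, -⟩ := hmem
    obtain ⟨k, hk⟩ := Projectivization.exists_smul_eq_mk_rep F _
      (hat_ne_zero c α (indep_triangular (b := b) hx hy).ne_zero_right)
    rw [pt, ← hk] at h1
    exact hy (by simpa [hat, Units.smul_def] using h1)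

end BaerLines

section SwitchedSpread

variable {F : Type} [Field F] {q : ℕ} {c : F →+* F}

/-- The `F_q`-linear map `k ↦ k + αᑫ kᑫ`. -/
def twist (c : F →+* F) (α k : F) : F := k + c α * c k

theorem twist_add (α k l : F) : twist c α (k + l) = twist c α k + twist c α l := by
  simp only [twist, map_add]
  ring

theorem twist_mul_of_fixed (α k : F) {r : F} (hr : c r = r) :
    twist c α (r * k) = r * twist c α k := by
  simp only [twist, map_mul, hr]
  ring

theorem twist_zero (α : F) : twist c α 0 = 0 := by simp [twist]

theorem IsPowConj.norm_eq_one_of_twist_eq_zero (hc : IsPowConj q c) {α k : F}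
    (h : twist c α k = 0) (hk : k ≠ 0) : α * c α = 1 := by
  have h1 : k + c α * c k = 0 := h
  have h2 := congrArg c h1
  simp only [map_add, map_mul, hc.invol, map_zero] at h2
  have : (α * c α - 1) * k = 0 := by linear_combination c α * h2 - h1
  exact sub_eq_zero.1 ((mul_eq_zero.1 this).resolve_right hk)

theorem IsPowConj.twist_ne_zero (hc : IsPowConj q c) {α k : F} (hα1 : α * c α ≠ 1)
    (hk : k ≠ 0) : twist c α k ≠ 0 :=
  fun h => hα1 (hc.norm_eq_one_of_twist_eq_zero h hk)

theorem IsPowConj.exists_twist_eq (hc : IsPowConj q c) {α : F} (hα1 : α * c α ≠ 1) (w : F) :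
    ∃ k, twist c α k = w := by
  have hd : 1 - α * c α ≠ 0 := sub_ne_zero.2 hα1.symm
  refine ⟨(w - c α * c w) / (1 - α * c α), ?_⟩
  have hcd : c (1 - α * c α) = 1 - α * c α := by
    simp only [map_sub, map_mul, map_one, hc.invol]
    ring
  rw [twist, map_div₀, hcd]
  simp only [map_sub, map_mul, hc.invol]
  rw [mul_div_assoc', ← add_div, div_eq_iff hd]
  ring

/-- The vectors attached to the points of the line of `Σ_1` lying on the line joining
`λ ê + μ f̂` and its image under `τ_1`. -/
def twistLine (c : F →+* F) (α : F) (e f : F × F) (x y : F) : Set (F × F) :=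
  Set.range fun k : F => twist c α (k * x) • e + twist c α (k * y) • f

theorem fixedClosed_twistLine (α : F) (e f : F × F) (x y : F) :
    FixedClosed c (twistLine c α e f x y) := by
  rintro r _ hr ⟨k, rfl⟩
  refine ⟨r * k, ?_⟩
  simp only [mul_assoc, twist_mul_of_fixed α _ hr, smul_add, smul_smul]

theorem twistLine_smul (α : F) (e f : F × F) (x y : F) {s : F} (hs : s ≠ 0) :
    twistLine c α e f (s * x) (s * y) = twistLine c α e f x y := by
  ext v
  constructor
  · rintro ⟨k, rfl⟩
    exact ⟨k * s, by simp only [mul_assoc]⟩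
  · rintro ⟨k, rfl⟩
    exact ⟨k / s, by simp only [← mul_assoc, div_mul_cancel₀ _ hs]⟩

theorem twistLine_eq_ray (hc : IsPowConj q c) {α : F} (hα1 : α * c α ≠ 1) (e f : F × F)
    {x y : F} (hx : c x = x) (hy : c y = y) :
    twistLine c α e f x y = ray (x • e + y • f) := by
  ext v
  constructor
  · rintro ⟨k, rfl⟩
    refine ⟨twist c α k, ?_⟩
    simp only [mul_comm k, twist_mul_of_fixed α _ hx, twist_mul_of_fixed α _ hy, smul_add,
      smul_smul, mul_comm (twist c α k)]
  · rintro ⟨w, rfl⟩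
    obtain ⟨k, rfl⟩ := hc.exists_twist_eq hα1 w
    refine ⟨k, ?_⟩
    simp only [mul_comm k, twist_mul_of_fixed α _ hx, twist_mul_of_fixed α _ hy, smul_add,
      smul_smul, mul_comm (twist c α k)]

theorem lineThrough_tau_inter_SigmaSet (hc : IsPowConj q c) {α : F} (hα1 : α * c α ≠ 1)
    {e f : F × F} (hef : Indep e f) {x y : F} {w : Fin 4 → F} (hw : w ≠ 0)
    (hxy : x • hat c α e + y • hat c α f = w) :
    lineThrough F (Projectivization.mk F w hw) (tau q F 1 (Projectivization.mk F w hw)) ∩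
      SigmaSet q F 1 = ptSet c 1 (twistLine c α e f x y) := by
  rw [inter_SigmaSet_eq_ptSet hc, tau_mk_s19 hc (one_pow _) hw (conj_swap_ne_zero c hw)]
  congr 1
  ext v
  have hcoord : ∀ k d : F, k • w + d • ![c (w 2), c (w 3), c (w 0), c (w 1)] =
      ![(k * x + d * c α * c x) * e.1 + (k * y + d * c α * c y) * f.1,
        (k * x + d * c α * c x) * e.2 + (k * y + d * c α * c y) * f.2,
        (k * x * α + d * c x) * c e.1 + (k * y * α + d * c y) * c f.1,
        (k * x * α + d * c x) * c e.2 + (k * y * α + d * c y) * c f.2] := by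
    intro k d
    rw [← hxy]
    ext i
    fin_cases i <;> simp [hat, hc.invol] <;> ring
  constructor
  · intro h
    by_cases hv : v = 0
    · exact ⟨0, by simp [hv, twist_zero]⟩
    obtain ⟨k, d, hkd⟩ := (mem_lineThrough_mk _ _ _).1 (h hv)
    rw [hcoord] at hkd
    have h0 := congrFun hkd 0
    have h1 := congrFun hkd 1
    have h2 := congrFun hkd 2
    have h3 := congrFun hkd 3
    simp only [hat, Matrix.cons_val, one_mul] at h0 h1 h2 h3
    have g2 := congrArg c h2
    have g3 := congrArg c h3
    simp only [map_add, map_mul, hc.invol] at g2 g3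
    rw [← h0] at g2
    rw [← h1] at g3
    have hv' : v = (k * x + d * c α * c x) • e + (k * y + d * c α * c y) • f := by
      ext
      · simp [← h0]
      · simp [← h1]
    obtain ⟨ex, ey⟩ := hef.eq (x := c k * c x * c α + c d * x) (y := c k * c y * c α + c d * y)
        (x' := k * x + d * c α * c x) (y' := k * y + d * c α * c y) (by
      ext
      · simpa using g2
      · simpa using g3)
    have hdk : d = c k := by
      have key : ∀ t : F, t ≠ 0 → c k * c t * c α + c d * t = k * t + d * c α * c t →
          d = c k := by
        intro t ht h
        by_contra hne
        have hω : (d - c k) * c t ≠ 0 := mul_ne_zero (sub_ne_zero.2 hne) ((map_ne_zero c).2 ht)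
        have hω' : (c d - k) * t ≠ 0 := by
          have := (map_ne_zero c).2 hω
          simpa [hc.invol] using this
        apply hα1
        have e1 : (c d - k) * t = c α * ((d - c k) * c t) := by linear_combination h
        have e2 := congrArg c e1
        simp only [map_mul, map_sub, hc.invol] at e2
        have : (α * c α - 1) * ((c d - k) * t) = 0 := by
          linear_combination -e1 - c α * e2
        exact sub_eq_zero.1 ((mul_eq_zero.1 this).resolve_right hω')
      by_cases hx : x = 0
      · refine key y ?_ ey
        rintro rfl
        exact hw (by rw [← hxy]; simp [hx])
      · exact key x hx ex
    refine ⟨k, ?_⟩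
    rw [hv', hdk]
    simp only [twist, map_mul]
    ring_nf
  · rintro ⟨k, rfl⟩ hv
    rw [pt, mem_lineThrough_mk]
    refine ⟨k, c k, ?_⟩
    rw [hcoord]
    ext i
    fin_cases i <;> simp [hat, twist, hc.invol] <;> ring

theorem mem_Sspread_baerLine (hc : IsPowConj q c) {α : F} (hα1 : α * c α ≠ 1)
    {e f : F × F} (hef : Indep e f) {m : Set (Pt F)} :
    m ∈ Sspread q F 1 (baerLine c α hef) ↔
      ∃ x y, (x ≠ 0 ∨ y ≠ 0) ∧ m = ptSet c 1 (twistLine c α e f x y) := by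
  constructor
  · rintro ⟨Q, hQ, rfl⟩
    rw [← Q.mk_rep, mk_mem_baerLine] at hQ
    obtain ⟨x, y, hxy⟩ := hQ
    refine ⟨x, y, ?_, ?_⟩
    · by_contra! h
      apply Q.rep_nonzero
      rw [← hxy]
      simp [h.1, h.2]
    · have := lineThrough_tau_inter_SigmaSet hc hα1 hef Q.rep_nonzero hxy
      rwa [Q.mk_rep] at this
  · rintro ⟨x, y, hne, rfl⟩
    have hw : x • hat c α e + y • hat c α f ≠ 0 := by
      intro h
      have h0 := hef x y (by
        ext
        · simpa [hat] using congrFun h 0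
        · simpa [hat] using congrFun h 1)
      rcases hne with hx | hy
      · exact hx h0.1
      · exact hy h0.2
    exact ⟨_, (mk_mem_baerLine hef hw).2 ⟨x, y, rfl⟩,
      (lineThrough_tau_inter_SigmaSet hc hα1 hef hw rfl).symm⟩

end SwitchedSpread

section SwitchedSpreadLines

variable {F : Type} [Field F] {q : ℕ} {c : F →+* F}

theorem mem_of_ptSet_eq {α : F} (hα : α ≠ 0) {X Y : Set (F × F)} (hY : FixedClosed c Y)
    (h : ptSet c α X = ptSet c α Y) {v : F × F} (hv : v ≠ 0) (hvX : v ∈ X) : v ∈ Y := by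
  have hmem : pt c α v hv ∈ ptSet c α X := ⟨v, hv, hvX, rfl⟩
  rw [h] at hmem
  exact (pt_mem_ptSet hα hY).1 hmem

theorem ptSet_ray_ne_of_indep {α : F} (hα : α ≠ 0) {a b : F × F} (h : Indep a b) :
    ptSet c α (ray a) ≠ ptSet c α (ray b) := fun he =>
  ray_ne_of_indep h (ray_eq_of_mem h.ne_zero_left
    (mem_of_ptSet_eq hα (fixedClosed_ray c b) he h.ne_zero_left (mem_ray_self a))).symm

theorem mem_ray_smul_add_iff {e f : F × F} (hef : Indep e f) {a b z : F} :
    a • e + b • f ∈ ray (z • e + f) ↔ a = z * b := by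
  constructor
  · rintro ⟨k, hk⟩
    obtain ⟨h1, h2⟩ := hef.eq (x := k * z) (y := k) (x' := a) (y' := b) (by
      rw [← hk]
      simp only [smul_add, smul_smul])
    rw [← h1, ← h2, mul_comm]
  · rintro rfl
    exact ⟨b, by simp only [smul_add, smul_smul, mul_comm]⟩

theorem IsPowConj.twist_injective (hc : IsPowConj q c) {α : F} (hα1 : α * c α ≠ 1) :
    Function.Injective (twist c α) := by
  intro k l h
  by_contra hne
  apply hc.twist_ne_zero hα1 (sub_ne_zero.2 hne)
  rw [sub_eq_add_neg, ← neg_one_mul, twist_add, twist_mul_of_fixed _ _ (by simp), h]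
  ring

theorem twistLine_eq_left (hc : IsPowConj q c) {α : F} (hα1 : α * c α ≠ 1) (e f : F × F)
    {x : F} (hx : x ≠ 0) : twistLine c α e f x 0 = ray e := by
  have := twistLine_smul (c := c) α e f 1 0 hx
  rw [mul_one, mul_zero, twistLine_eq_ray hc hα1 e f (map_one c) (map_zero c)] at this
  simpa using this

theorem mem_Sspread_iff_s19 (hc : IsPowConj q c) {α : F} (hα1 : α * c α ≠ 1)
    {e f : F × F} (hef : Indep e f) {m : Set (Pt F)} :
    m ∈ Sspread q F 1 (baerLine c α hef) ↔
      m = ptSet c 1 (ray e) ∨ ∃ x, m = ptSet c 1 (twistLine c α e f x 1) := by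
  rw [mem_Sspread_baerLine hc hα1]
  constructor
  · rintro ⟨x, y, h, rfl⟩
    by_cases hy : y = 0
    · rw [hy, twistLine_eq_left hc hα1 e f (h.resolve_right (not_not.2 hy))]
      exact Or.inl rfl
    · right
      refine ⟨x / y, ?_⟩
      rw [← twistLine_smul α e f (x / y) 1 hy, mul_div_cancel₀ _ hy, mul_one]
  · rintro (rfl | ⟨x, rfl⟩)
    · exact ⟨1, 0, Or.inl one_ne_zero, by rw [twistLine_eq_left hc hα1 e f one_ne_zero]⟩
    · exact ⟨x, 1, Or.inr one_ne_zero, rfl⟩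

theorem twistLine_vector_ne_zero (hc : IsPowConj q c) {α : F} (hα1 : α * c α ≠ 1)
    {e f : F × F} (hef : Indep e f) {k x : F} (hk : k ≠ 0) :
    twist c α (k * x) • e + twist c α k • f ≠ 0 :=
  fun h => hc.twist_ne_zero hα1 hk (hef _ _ h).2

theorem mem_twistLine_one {α : F} (e f : F × F) (k x : F) :
    twist c α (k * x) • e + twist c α k • f ∈ twistLine c α e f x 1 :=
  ⟨k, by simp⟩

theorem ptSet_twistLine_mem_Dspread (hc : IsPowConj q c) {α : F} (hα0 : α ≠ 0)
    (hα1 : α * c α ≠ 1) {e f : F × F} (hef : Indep e f) {x : F} :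
    ptSet c 1 (twistLine c α e f x 1) ∈ Dspread q F 1 ↔ c x = x := by
  rw [mem_Dspread hc]
  constructor
  · rintro ⟨a, -, h⟩
    have hmem : ∀ k, k ≠ 0 → twist c α (k * x) • e + twist c α k • f ∈ ray a := fun k hk =>
      mem_of_ptSet_eq one_ne_zero (fixedClosed_ray c a) h
        (twistLine_vector_ne_zero hc hα1 hef hk) (mem_twistLine_one e f k x)
    by_cases hx : x = 0
    · simp [hx]
    have h1 := hmem 1 one_ne_zero
    have hxx := hmem x hx
    rw [ray_eq_of_mem (twistLine_vector_ne_zero hc hα1 hef one_ne_zero) h1] at hxx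
    obtain ⟨l, hl⟩ := hxx
    simp only [smul_add, smul_smul] at hl
    obtain ⟨e1, e2⟩ := hef.eq hl
    simp only [twist, one_mul, map_mul, map_one, mul_one] at e1 e2
    have key : c α * ((c x - x) * (c x - x)) = 0 := by
      linear_combination (x + c α * c x) * e2 - (1 + c α) * e1
    have hcα : c α ≠ 0 := (map_ne_zero c).2 hα0
    exact sub_eq_zero.1 (mul_self_eq_zero.1 ((mul_eq_zero.1 key).resolve_left hcα))
  · intro hx
    refine ⟨x • e + f, ?_, ?_⟩
    · intro h
      exact one_ne_zero (hef x 1 (by simpa using h)).2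
    · rw [twistLine_eq_ray hc hα1 e f hx (map_one c), one_smul]

theorem ptSet_twistLine_injective (hc : IsPowConj q c) {α : F} (hα1 : α * c α ≠ 1)
    {e f : F × F} (hef : Indep e f) {x y : F}
    (h : ptSet c 1 (twistLine c α e f x 1) = ptSet c 1 (twistLine c α e f y 1)) : x = y := by
  have hv := twistLine_vector_ne_zero hc hα1 hef (x := x) one_ne_zero
  obtain ⟨k, hk⟩ := mem_of_ptSet_eq one_ne_zero (fixedClosed_twistLine α e f y 1) h hv
    (mem_twistLine_one e f 1 x)
  obtain ⟨h1, h2⟩ := hef.eq hk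
  rw [mul_one] at h2
  rw [hc.twist_injective hα1 h2, one_mul, one_mul] at h1
  exact (hc.twist_injective hα1 h1).symm

theorem twistLine_inter_ray_nonempty_iff (hc : IsPowConj q c) {α : F} (hα0 : α ≠ 0)
    (hne : ∃ z, c z ≠ z) (hα1 : α * c α ≠ 1) {e f : F × F} (hef : Indep e f) {x z : F}
    (hx : c x ≠ x) : (ptSet c 1 (twistLine c α e f x 1) ∩
      ptSet c 1 (ray (z • e + f))).Nonempty ↔ OnCircle c α x z := by
  rw [ptSet_inter_nonempty one_ne_zero (fixedClosed_ray c _)]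
  constructor
  · rintro ⟨_, hv, ⟨k, rfl⟩, hr⟩
    simp only [mul_one] at hv hr
    have hk : k ≠ 0 := by
      rintro rfl
      simp [twist_zero] at hv
    have h := (mem_ray_smul_add_iff hef).1 hr
    simp only [twist, map_mul] at h
    have h' := congrArg c h
    simp only [map_mul, map_add, hc.invol] at h'
    have hck : c k ≠ 0 := (map_ne_zero c).2 hk
    have key : k * c k * ((z - x) * (c z - c x) - α * c α * ((z - c x) * (c z - x))) = 0 := by
      linear_combination k * (x - z) * h' + α * k * (c z - x) * h
    exact sub_eq_zero.1 ((mul_eq_zero.1 key).resolve_left (mul_ne_zero hk hck))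
  · intro h
    have hcα : c α ≠ 0 := (map_ne_zero c).2 hα0
    have hz : z ≠ c x := by
      rintro rfl
      rw [OnCircle, hc.invol] at h
      have : (c x - x) * (x - c x) = 0 := by linear_combination h
      rcases mul_eq_zero.1 this with h | h
      · exact hx (sub_eq_zero.1 h)
      · exact hx (sub_eq_zero.1 h).symm
    have hd : c α * (z - c x) ≠ 0 := mul_ne_zero hcα (sub_ne_zero.2 hz)
    have hd' : α * (c z - x) ≠ 0 := by
      have := (map_ne_zero c).2 hd
      simpa [hc.invol] using this
    obtain ⟨k, hk, hck⟩ := hc.exists_eq_mul hne (u := (x - z) / (c α * (z - c x))) (by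
      rw [map_div₀]
      simp only [map_mul, map_sub, hc.invol]
      rw [div_mul_div_comm, div_eq_one_iff_eq (mul_ne_zero hd hd')]
      rw [OnCircle] at h
      linear_combination h)
    rw [div_mul_eq_mul_div, eq_div_iff hd] at hck
    refine ⟨_, twistLine_vector_ne_zero hc hα1 hef hk, mem_twistLine_one e f k x, ?_⟩
    rw [mem_ray_smul_add_iff hef]
    simp only [twist, map_mul]
    linear_combination -hck

theorem eq_lineThrough_inter_of_meets {t : Set (Pt F)} (ht : IsLineOfSigma q F 1 t)
    {P Q : Pt F} (hP : P ∈ t) (hQ : Q ∈ t) (h : P ≠ Q) :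
    t = lineThrough F P Q ∩ SigmaSet q F 1 := by
  obtain ⟨s, hs, rfl, -⟩ := ht
  rw [← hs.eq_lineThrough hP.1 hQ.1 h]

theorem ptSet_subset_SigmaSet (hc : IsPowConj q c) {α : F} (X : Set (F × F)) :
    ptSet c α X ⊆ SigmaSet q F α := by
  rintro _ ⟨v, hv, -, rfl⟩
  exact (mem_SigmaSet hc).2 ⟨v, hv, rfl⟩

theorem ptSet_ray_disjoint_of_indep {α : F} (hα : α ≠ 0) {a b : F × F} (h : Indep a b)
    {P Q : Pt F} (hP : P ∈ ptSet c α (ray a)) (hQ : Q ∈ ptSet c α (ray b)) : P ≠ Q := by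
  rintro rfl
  obtain ⟨v, hv, ha, hb⟩ := (ptSet_inter_nonempty hα (fixedClosed_ray c b)).1 ⟨P, hP, hQ⟩
  exact ray_ne_of_indep h ((ray_eq_of_mem hv ha).trans (ray_eq_of_mem hv hb).symm)

theorem mem_Rreg_iff (hc : IsPowConj q c) {α : F} (hα0 : α ≠ 0) (hα1 : α * c α ≠ 1)
    {e f : F × F} (hef : Indep e f) {m : Set (Pt F)} :
    m ∈ Rreg q F 1 (baerLine c α hef) ↔
      m = ptSet c 1 (ray e) ∨ ∃ x, c x = x ∧ m = ptSet c 1 (ray (x • e + f)) := by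
  rw [Rreg, Set.mem_inter_iff, mem_Sspread_iff_s19 hc hα1]
  constructor
  · rintro ⟨hD, rfl | ⟨x, rfl⟩⟩
    · exact Or.inl rfl
    · have hx := (ptSet_twistLine_mem_Dspread hc hα0 hα1 hef).1 hD
      refine Or.inr ⟨x, hx, ?_⟩
      rw [twistLine_eq_ray hc hα1 e f hx (map_one c), one_smul]
  · rintro (rfl | ⟨x, hx, rfl⟩)
    · exact ⟨(mem_Dspread hc).2 ⟨e, hef.ne_zero_left, rfl⟩, Or.inl rfl⟩
    · have h := twistLine_eq_ray hc hα1 e f hx (map_one c)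
      rw [one_smul] at h
      rw [← h]
      exact ⟨(ptSet_twistLine_mem_Dspread hc hα0 hα1 hef).2 hx, Or.inr ⟨x, rfl⟩⟩

/-- The lines of the opposite regulus meet the same lines of the Desarguesian spread. -/
theorem Ropp_meets_of_meets (hc : IsPowConj q c) {α : F} (hα0 : α ≠ 0) (hα1 : α * c α ≠ 1)
    {e f : F × F} (hef : Indep e f) {t t' m : Set (Pt F)}
    (ht : t ∈ Ropp q F 1 (baerLine c α hef)) (ht' : t' ∈ Ropp q F 1 (baerLine c α hef))
    (hm : m ∈ Dspread q F 1) (h : (t ∩ m).Nonempty) : (t' ∩ m).Nonempty := by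
  have h13 : Indep e (e + f) := fun x y h => by
    have := hef (x + y) y (by rw [← h, add_smul, smul_add]; abel)
    obtain ⟨h1, rfl⟩ := this
    exact ⟨by simpa using h1, rfl⟩
  have h23 : Indep f (e + f) := fun x y h => by
    have := hef y (x + y) (by rw [← h, add_smul, smul_add]; abel)
    obtain ⟨rfl, h1⟩ := this
    exact ⟨by simpa using h1, rfl⟩
  have R1 : ptSet c 1 (ray e) ∈ Rreg q F 1 (baerLine c α hef) :=
    (mem_Rreg_iff hc hα0 hα1 hef).2 (Or.inl rfl)
  have R2 : ptSet c 1 (ray f) ∈ Rreg q F 1 (baerLine c α hef) :=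
    (mem_Rreg_iff hc hα0 hα1 hef).2 (Or.inr ⟨0, map_zero c, by simp⟩)
  have R3 : ptSet c 1 (ray (e + f)) ∈ Rreg q F 1 (baerLine c α hef) :=
    (mem_Rreg_iff hc hα0 hα1 hef).2 (Or.inr ⟨1, map_one c, by simp⟩)
  obtain ⟨P₁, hP₁, hP₁'⟩ := ht.2 _ R1
  obtain ⟨P₂, hP₂, hP₂'⟩ := ht.2 _ R2
  obtain ⟨P₃, hP₃, hP₃'⟩ := ht.2 _ R3
  obtain ⟨Q₁, hQ₁, hQ₁'⟩ := ht'.2 _ R1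
  obtain ⟨Q₂, hQ₂, hQ₂'⟩ := ht'.2 _ R2
  obtain ⟨Q₃, hQ₃, hQ₃'⟩ := ht'.2 _ R3
  obtain ⟨P, hP, hP'⟩ := h
  have et := eq_lineThrough_inter_of_meets ht.1 hP₁ hP₂
    (ptSet_ray_disjoint_of_indep one_ne_zero hef hP₁' hP₂')
  have et' := eq_lineThrough_inter_of_meets ht'.1 hQ₁ hQ₂
    (ptSet_ray_disjoint_of_indep one_ne_zero hef hQ₁' hQ₂')
  obtain ⟨Q, hQm, hQ⟩ := hasReguli_Dspread hc _ R1.1 _ R2.1 _ R3.1 m hm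
    (ptSet_ray_ne_of_indep one_ne_zero hef) (ptSet_ray_ne_of_indep one_ne_zero h13)
    (ptSet_ray_ne_of_indep one_ne_zero h23) P₁ hP₁' P₂ hP₂' P₃ hP₃' P hP' Q₁ hQ₁' Q₂ hQ₂'
    Q₃ hQ₃' (et ▸ hP₃).1 (et' ▸ hQ₃).1 (et ▸ hP).1
  refine ⟨Q, ?_, hQm⟩
  rw [et']
  refine ⟨hQ, ?_⟩
  obtain ⟨a, -, rfl⟩ := (mem_Dspread hc).1 hm
  exact ptSet_subset_SigmaSet hc _ hQm

theorem span_mem_Ropp [Fintype F] (hc : IsPowConj q c) (hcard : {x | c x = x}.ncard = q)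
    {α : F} (hα0 : α ≠ 0) (hα1 : α * c α ≠ 1) {e f : F × F} (hef : Indep e f) {k : F}
    (hk : k ≠ 0) :
    ptSet c 1 {v | ∃ x y, c x = x ∧ c y = y ∧ v = x • (k • e) + y • (k • f)} ∈
      Ropp q F 1 (baerLine c α hef) := by
  have hi := hef.smul hk
  refine ⟨⟨baerLine c 1 hi, isLine_lineThrough (pt_ne_pt one_ne_zero hi),
    (baerLine_inter_SigmaSet hc one_ne_zero hi).symm,
    ncard_ptSet_span one_ne_zero hcard hi⟩, ?_⟩
  intro m hm
  rcases (mem_Rreg_iff hc hα0 hα1 hef).1 hm with rfl | ⟨x, hx, rfl⟩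
  · rw [ptSet_inter_nonempty one_ne_zero (fixedClosed_ray c _)]
    exact ⟨k • e, hi.ne_zero_left, ⟨1, 0, map_one c, map_zero c, by simp⟩, ⟨k, rfl⟩⟩
  · rw [ptSet_inter_nonempty one_ne_zero (fixedClosed_ray c _)]
    refine ⟨k • (x • e + f), ?_, ⟨x, 1, hx, map_one c, ?_⟩, ⟨k, rfl⟩⟩
    · refine smul_ne_zero hk fun h => ?_
      exact one_ne_zero (hef x 1 (by simpa using h)).2
    · rw [smul_add, one_smul, smul_comm]

theorem indep_smul_add {e f : F × F} (hef : Indep e f) (p : F) {r : F} (hr : r ≠ 0) :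
    Indep (p • e + r • f) ((p + r) • e + r • f) := by
  intro x y h
  obtain ⟨h1, h2⟩ := hef (x * p + y * (p + r)) (x * r + y * r) (by
    rw [← h]
    module)
  have hxy : x + y = 0 :=
    (mul_eq_zero.1 (by linear_combination h2 : (x + y) * r = 0)).resolve_right hr
  have hy : y = 0 :=
    (mul_eq_zero.1 (by linear_combination h1 - p * hxy : y * r = 0)).resolve_right hr
  exact ⟨by simpa [hy] using hxy, hy⟩

/-- The spread obtained from `S_ℓ` by switching the regulus `R_ℓ`. -/
def switchedSpread (q : ℕ) (ℓ : Set (Pt F)) : Set (Set (Pt F)) :=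
  (Sspread q F 1 ℓ \ Rreg q F 1 ℓ) ∪ Ropp q F 1 ℓ

theorem twistLine_mem_switchedSpread (hc : IsPowConj q c) {α : F} (hα0 : α ≠ 0)
    (hα1 : α * c α ≠ 1) {e f : F × F} (hef : Indep e f) {x : F} (hx : c x ≠ x) :
    ptSet c 1 (twistLine c α e f x 1) ∈ switchedSpread q (baerLine c α hef) :=
  Or.inl ⟨(mem_Sspread_iff_s19 hc hα1 hef).2 (Or.inr ⟨x, rfl⟩),
    fun h => hx ((ptSet_twistLine_mem_Dspread hc hα0 hα1 hef).1 h.1)⟩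

theorem not_hasReguli_switchedSpread [Fintype F] (hc : IsPowConj q c) (hq3 : 3 ≤ q)
    (hF : Fintype.card F = q ^ 2) {α : F} (hα0 : α ≠ 0) (hα1 : α * c α ≠ 1) {e f : F × F}
    (hef : Indep e f) : ¬ HasReguli (switchedSpread q (baerLine c α hef)) := by
  obtain ⟨μ, hμ⟩ := hc.exists_ne hq3 hF
  obtain ⟨s, hs, hs0, hs1⟩ := hc.exists_third hq3 hF
  have hμ0 : μ ≠ 0 := by rintro rfl; simp at hμ
  have hμ' : ∀ r, c r = r → c (μ + r) ≠ μ + r := fun r hr h => hμ (by simpa [hr] using h)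
  have hne : ∀ r r', r ≠ r' → ptSet c 1 (twistLine c α e f (μ + r) 1) ≠
      ptSet c 1 (twistLine c α e f (μ + r') 1) := fun r r' h he =>
    h (add_left_cancel (ptSet_twistLine_injective hc hα1 hef he))
  have hmem : ∀ k, k ≠ 0 → ∀ r, ∃ h, pt c 1 (twist c α (k * (μ + r)) • e + twist c α k • f) h ∈
      ptSet c 1 (twistLine c α e f (μ + r) 1) := fun k hk r =>
    ⟨twistLine_vector_ne_zero hc hα1 hef hk, _, _, mem_twistLine_one e f k (μ + r), rfl⟩
  have hvec : ∀ k r, c r = r → twist c α (k * (μ + r)) = twist c α (k * μ) + r * twist c α k :=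
    fun k r hr => by rw [mul_add, twist_add, mul_comm k r, twist_mul_of_fixed _ _ hr]
  have hind : ∀ k, k ≠ 0 → Indep (twist c α (k * (μ + 0)) • e + twist c α k • f)
      (twist c α (k * (μ + 1)) • e + twist c α k • f) := fun k hk => by
    rw [hvec k 1 (map_one c), add_zero, one_mul]
    exact indep_smul_add hef _ (hc.twist_ne_zero hα1 hk)
  have hthird : ∀ k, twist c α (k * (μ + s)) • e + twist c α k • f =
      (1 - s) • (twist c α (k * (μ + 0)) • e + twist c α k • f) +
        s • (twist c α (k * (μ + 1)) • e + twist c α k • f) := fun k => by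
    rw [hvec k 1 (map_one c), hvec k s hs, add_zero]
    module
  have h1s : c (1 - s) = 1 - s := by simp [hs]
  have hθ := hc.twist_ne_zero hα1 (one_ne_zero (α := F))
  intro hreg
  obtain ⟨p1, hp1⟩ := hmem 1 one_ne_zero 0
  obtain ⟨p2, hp2⟩ := hmem 1 one_ne_zero 1
  obtain ⟨p3, hp3⟩ := hmem 1 one_ne_zero s
  obtain ⟨q1, hq1⟩ := hmem μ hμ0 0
  obtain ⟨q2, hq2⟩ := hmem μ hμ0 1
  obtain ⟨q3, hq3'⟩ := hmem μ hμ0 s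
  obtain ⟨Q, ⟨w, hw, ⟨x, y, hx, hy, hxy⟩, rfl⟩, hQ⟩ := hreg
    _ (twistLine_mem_switchedSpread hc hα0 hα1 hef (hμ' 0 (map_zero c)))
    _ (twistLine_mem_switchedSpread hc hα0 hα1 hef (hμ' 1 (map_one c)))
    _ (twistLine_mem_switchedSpread hc hα0 hα1 hef (hμ' s hs))
    _ (Or.inr (span_mem_Ropp hc (hc.ncard_fixed hq3 hF) hα0 hα1 hef hθ))
    (hne _ _ zero_ne_one) (hne _ _ hs0.symm) (hne _ _ hs1.symm)
    _ hp1 _ hp2 _ hp3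
    (pt c 1 (twist c α 1 • e) (smul_ne_zero hθ hef.ne_zero_left))
    ⟨_, _, ⟨1, 0, map_one c, map_zero c, by simp⟩, rfl⟩
    _ hq1 _ hq2 _ hq3'
    ((pt_mem_lineThrough_iff hc one_ne_zero (hind 1 one_ne_zero)).2
      ⟨1 - s, s, h1s, hs, hthird 1⟩)
    ((pt_mem_lineThrough_iff hc one_ne_zero (hind μ hμ0)).2 ⟨1 - s, s, h1s, hs, hthird μ⟩)
    ((pt_mem_lineThrough_iff hc one_ne_zero (hind 1 one_ne_zero)).2
      ⟨-1, 1, by simp, map_one c, by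
        rw [hvec 1 1 (map_one c), add_zero]
        module⟩)
  obtain ⟨a, b, ha, hb, hab⟩ := (pt_mem_lineThrough_iff hc one_ne_zero (hind μ hμ0)).1 hQ
  rw [hvec μ 1 (map_one c), add_zero, hxy] at hab
  obtain ⟨h1, h2⟩ := hef.eq (x := x * twist c α 1) (y := y * twist c α 1)
    (x' := (a + b) * twist c α (μ * μ) + b * twist c α μ) (y' := (a + b) * twist c α μ) (by
      rw [← smul_smul, ← smul_smul, hab]
      module)
  have hab' : c (a + b) = a + b := by simp [ha, hb]
  rw [← twist_mul_of_fixed _ _ hy, ← twist_mul_of_fixed _ _ hab'] at h2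
  rw [← twist_mul_of_fixed _ _ hx, ← twist_mul_of_fixed _ _ hab', ← twist_mul_of_fixed _ _ hb,
    ← twist_add] at h1
  replace h1 := hc.twist_injective hα1 h1
  replace h2 := hc.twist_injective hα1 h2
  rw [mul_one] at h1 h2
  have fixed_mul : ∀ r z, c r = r → c z = z → z = r * μ → r = 0 := fun r z hr hz h => by
    by_contra hr0
    apply hμ
    have := congrArg c h
    rw [hz, map_mul, hr, h] at this
    exact (mul_left_cancel₀ hr0 this).symm
  have hs' := fixed_mul _ _ hab' hy h2
  rw [hs', zero_mul, zero_add] at h1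
  have hb0 := fixed_mul _ _ hb hx h1
  rw [hs', zero_mul] at h2
  rw [hb0, zero_mul] at h1
  exact hw (by rw [hxy, h1, h2]; simp)

end SwitchedSpreadLines

section DistinguishedLine

variable {F : Type} [Field F] {q : ℕ} {c : F →+* F}

/-- For each member `S ≠ D` of `Pl`, any two elements of `S` meeting `m` meet the same elements
of `D`. -/
def MeetsCompatibly (Pl : Set (Set (Set (Pt F)))) (D : Set (Set (Pt F))) (m : Set (Pt F)) :
    Prop :=
  ∀ S ∈ Pl, S ≠ D → ∀ t ∈ S, ∀ t' ∈ S, (t ∩ m).Nonempty → (t' ∩ m).Nonempty →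
    ∀ m' ∈ D, (t ∩ m').Nonempty → (t' ∩ m').Nonempty

/-- The conditions on the triples of a good set that do not involve pairs of triples. -/
def IsAdmissible (c : F →+* F) (t : F × F × F) : Prop :=
  t.1 ≠ 0 ∧ t.1 * c t.1 ≠ 1 ∧ t.2.1 * c t.2.1 = 1 ∧ t.2.2 * c t.2.2 = 1

theorem IsGoodSet.isAdmissible (hc : IsPowConj q c) {I : Set F} (hI : IsIndexSet q F I)
    {G : Finset (F × F × F)} (hG : IsGoodSet q F I G) : ∀ t ∈ G, IsAdmissible c t := by
  intro t ht
  obtain ⟨h1, h2, h3⟩ := hG.2.1 t ht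
  have hpow : ∀ x : F, x * c x = x ^ (q + 1) := fun x => by rw [pow_succ', hc.pow_eq]
  refine ⟨?_, ?_, (hpow _).trans h2, (hpow _).trans h3⟩
  · exact fun h => hI.1 (h ▸ h1)
  · rw [hpow]
    exact fun h => hI.2.2.2.1 ⟨_, h1, h⟩

theorem exists_switchedSpread_of_mem_ParP (hc : IsPowConj q c) (hq : 0 < q)
    (hne : ∃ z, c z ≠ z) {G : Finset (F × F × F)} (hG : ∀ t ∈ G, IsAdmissible c t)
    {S : Set (Set (Pt F))} (hS : S ∈ ParP q F 1 G) (hSD : S ≠ Dspread q F 1) :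
    ∃ α x b y, ∃ hx : x ≠ 0, ∃ hy : y ≠ 0, α ≠ 0 ∧ α * c α ≠ 1 ∧
      S = switchedSpread q (baerLine c α (indep_triangular (b := b) hx hy)) := by
  obtain ⟨ℓ, hℓ, rfl⟩ := hS.resolve_right hSD
  simp only [Lset, Set.mem_iUnion] at hℓ
  obtain ⟨t, ht, hℓ, hr⟩ := hℓ
  obtain ⟨hα0, hα1, hu, -⟩ := hG t ht
  obtain ⟨x, b, y, hx, hy, rfl⟩ := exists_eq_baerLine_of_mem_pencil hc hq hne hα0 hu hℓ hr
  exact ⟨_, x, b, y, hx, hy, hα0, hα1, rfl⟩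

theorem meetsCompatibly_ray (hc : IsPowConj q c) (hq : 0 < q) (hne : ∃ z, c z ≠ z)
    {G : Finset (F × F × F)} (hG : ∀ t ∈ G, IsAdmissible c t) :
    MeetsCompatibly (ParP q F 1 G) (Dspread q F 1) (ptSet c 1 (ray (1, 0))) := by
  intro S hS hSD
  obtain ⟨α, x, b, y, hx, hy, hα0, hα1, rfl⟩ :=
    exists_switchedSpread_of_mem_ParP hc hq hne hG hS hSD
  have hef := indep_triangular (b := b) hx hy
  have hopp : ∀ t ∈ switchedSpread q (baerLine c α hef),
      (t ∩ ptSet c 1 (ray (1, 0))).Nonempty → t ∈ Ropp q F 1 (baerLine c α hef) := by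
    rw [ray_eq_of_mem (a := (1, 0)) (v := ((x, 0) : F × F)) hef.ne_zero_left ⟨x, by simp⟩]
    rintro t (⟨ht, htR⟩ | ht) h
    · exfalso
      rcases (mem_Sspread_iff_s19 hc hα1 hef).1 ht with rfl | ⟨μ, rfl⟩
      · exact htR ((mem_Rreg_iff hc hα0 hα1 hef).2 (Or.inl rfl))
      · obtain ⟨_, hv, ⟨k, rfl⟩, l, hl⟩ :=
          (ptSet_inter_nonempty one_ne_zero (fixedClosed_ray c _)).1 h
        obtain ⟨-, h2⟩ := hef.eq (x := l) (y := 0) (x' := twist c α (k * μ))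
          (y' := twist c α (k * 1)) (by rw [zero_smul, add_zero]; exact hl)
        rw [mul_one] at h2
        have hk : k = 0 := by
          by_contra hk
          exact hc.twist_ne_zero hα1 hk h2.symm
        simp [hk, twist_zero] at hv
    · exact ht
  exact fun t ht t' ht' hm hm' m' hD h =>
    Ropp_meets_of_meets hc hα0 hα1 hef (hopp t ht hm) (hopp t' ht' hm') hD h

theorem eq_ray_of_meetsCompatibly [Fintype F] (hc : IsPowConj q c) (hq3 : 3 ≤ q)
    (hF : Fintype.card F = q ^ 2) {G : Finset (F × F × F)} (hG : ∀ t ∈ G, IsAdmissible c t)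
    (hGne : G.Nonempty) {m : Set (Pt F)} (hm : m ∈ Dspread q F 1)
    (h : MeetsCompatibly (ParP q F 1 G) (Dspread q F 1) m) :
    m = ptSet c 1 (ray (1, 0)) := by
  have hne := hc.exists_ne hq3 hF
  obtain ⟨⟨a₁, a₂⟩, ha, rfl⟩ := (mem_Dspread hc).1 hm
  by_contra hm0
  have ha₂ : a₂ ≠ 0 := by
    rintro rfl
    apply hm0
    rw [ray_eq_of_mem (a := (1, 0)) ha ⟨a₁, by simp⟩]
  obtain ⟨⟨α, u, v⟩, ht⟩ := hGne
  obtain ⟨hα0, hα1, hu, hv⟩ := hG _ ht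
  simp only at hα0 hα1 hu hv
  obtain ⟨x, hx, hxu⟩ := hc.exists_eq_mul hne hu
  obtain ⟨y, hy, hyv⟩ := hc.exists_eq_mul hne hv
  obtain ⟨ζ, hζ⟩ := hne
  obtain ⟨b, hb⟩ : ∃ b, ζ • ((x, 0) : F × F) + (b, y) = (y / a₂) • (a₁, a₂) :=
    ⟨y / a₂ * a₁ - ζ * x, by ext <;> simp [ha₂]⟩
  have hef := indep_triangular (b := b) hx hy
  have hray : ray ((a₁, a₂) : F × F) = ray (ζ • (x, 0) + (b, y)) := by
    rw [hb]
    exact ray_eq_of_mem (smul_ne_zero (div_ne_zero hy ha₂) ha) ⟨_, rfl⟩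
  have hS : switchedSpread q (baerLine c α hef) ∈ ParP q F 1 G := by
    refine Or.inl ⟨baerLine c α hef, ?_, rfl⟩
    simp only [Lset, Set.mem_iUnion]
    exact ⟨_, ht, baerLine_mem_pencil hc (hc.ncard_fixed hq3 hF) hα0 hx hy hxu hyv⟩
  have hSD : switchedSpread q (baerLine c α hef) ≠ Dspread q F 1 := fun he => by
    have := twistLine_mem_switchedSpread hc hα0 hα1 hef hζ
    rw [he] at this
    exact hζ ((ptSet_twistLine_mem_Dspread hc hα0 hα1 hef).1 this)
  obtain ⟨μ, hμ, hμζ⟩ := hc.exists_three_onCircle ⟨ζ, hζ⟩ hα0 hα1 hζ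
  obtain ⟨z, hz, hzμ⟩ := hc.exists_three_onCircle ⟨ζ, hζ⟩ hα0 hα1 (hμζ 0).1
  have hiff := fun (i : Fin 3) (w : F) =>
    twistLine_inter_ray_nonempty_iff hc hα0 ⟨ζ, hζ⟩ hα1 hef (z := w) (hμζ i).1
  refine hc.not_forall_onCircle hα1 hμ hz fun i j => (hiff i (z j)).1 ?_
  refine h _ hS hSD _ (twistLine_mem_switchedSpread hc hα0 hα1 hef (hμζ 0).1)
    _ (twistLine_mem_switchedSpread hc hα0 hα1 hef (hμζ i).1) ?_ ?_ _ ?_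
    ((hiff 0 (z j)).2 (hzμ j).2)
  · rw [hray]
    exact (hiff 0 ζ).2 (hμζ 0).2.symm
  · rw [hray]
    exact (hiff i ζ).2 (hμζ i).2.symm
  · refine (mem_Dspread hc).2 ⟨_, fun h0 => ?_, rfl⟩
    exact one_ne_zero (hef (z j) 1 (by simpa using h0)).2

end DistinguishedLine

section Collineations

variable {F : Type} [Field F] {q : ℕ} {c : F →+* F}

theorem pt_eq_pt_one_smul {η x : F} (hx : x ≠ 0) (hxη : c x = η * x) {v : F × F} (hv : v ≠ 0) :
    pt c η v hv = pt c 1 (x • v) (smul_ne_zero hx hv) := by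
  rw [pt, pt, Projectivization.mk_eq_mk_iff']
  refine ⟨x⁻¹, ?_⟩
  rw [inv_smul_eq_iff₀ hx]
  ext i
  fin_cases i <;> simp [hat, hxη] <;> ring

theorem SigmaSet_eq_of_norm_one (hc : IsPowConj q c) (hne : ∃ z, c z ≠ z) {η : F}
    (hη : η * c η = 1) : SigmaSet q F η = SigmaSet q F 1 := by
  obtain ⟨x, hx, hxη⟩ := hc.exists_eq_mul hne hη
  ext P
  rw [mem_SigmaSet hc, mem_SigmaSet hc]
  constructor
  · rintro ⟨v, hv, rfl⟩
    exact ⟨_, _, pt_eq_pt_one_smul hx hxη hv⟩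
  · rintro ⟨v, hv, rfl⟩
    refine ⟨x⁻¹ • v, smul_ne_zero (inv_ne_zero hx) hv, ?_⟩
    rw [pt_eq_pt_one_smul hx hxη]
    simp only [smul_inv_smul₀ hx]

theorem tau_eq_tau_one {η : F} (hη : η ^ (q + 1) = 1) : tau q F η = tau q F 1 := by
  have : tauFun q F η = tauFun q F 1 := by
    ext v
    simp [tauFun, hη]
  ext P
  simp only [tau, this]

theorem Dspread_eq_of_norm_one {η : F} (hS : SigmaSet q F η = SigmaSet q F 1) :
    Dspread q F η = Dspread q F 1 := by
  simp only [Dspread, hS]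

theorem ParP_eq_of_norm_one {η : F} (hS : SigmaSet q F η = SigmaSet q F 1)
    (hτ : tau q F η = tau q F 1) (G : Finset (F × F × F)) : ParP q F η G = ParP q F 1 G := by
  simp only [ParP, Ropp, Rreg, Sspread, Dspread, IsLineOfSigma, hS, hτ]

theorem HasReguli.image {S : Set (Set (Pt F))} (hS : HasReguli S) {ψ : Pt F → Pt F}
    (hline : ∀ A B P, ψ P ∈ lineThrough F (ψ A) (ψ B) ↔ P ∈ lineThrough F A B) :
    HasReguli ((fun m => ψ '' m) '' S) := by
  rintro _ ⟨m₁, hm₁, rfl⟩ _ ⟨m₂, hm₂, rfl⟩ _ ⟨m₃, hm₃, rfl⟩ _ ⟨m, hm, rfl⟩ h12 h13 h23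
    _ ⟨P₁, hP₁, rfl⟩ _ ⟨P₂, hP₂, rfl⟩ _ ⟨P₃, hP₃, rfl⟩ _ ⟨P, hP, rfl⟩
    _ ⟨Q₁, hQ₁, rfl⟩ _ ⟨Q₂, hQ₂, rfl⟩ _ ⟨Q₃, hQ₃, rfl⟩ h h' h''
  rw [hline] at h h' h''
  obtain ⟨Q, hQ, hQl⟩ := hS m₁ hm₁ m₂ hm₂ m₃ hm₃ m hm (fun e => h12 (e ▸ rfl))
    (fun e => h13 (e ▸ rfl)) (fun e => h23 (e ▸ rfl)) P₁ hP₁ P₂ hP₂ P₃ hP₃ P hP Q₁ hQ₁ Q₂ hQ₂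
    Q₃ hQ₃ h h' h''
  exact ⟨ψ Q, ⟨Q, hQ, rfl⟩, (hline _ _ _).2 hQl⟩

theorem MeetsCompatibly.image {Pl : Set (Set (Set (Pt F)))} {D : Set (Set (Pt F))}
    {m : Set (Pt F)} (h : MeetsCompatibly Pl D m) {ψ : Pt F → Pt F}
    (hinj : Function.Injective ψ) :
    MeetsCompatibly ((fun S => (fun m => ψ '' m) '' S) '' Pl) ((fun m => ψ '' m) '' D)
      (ψ '' m) := by
  have hmeet : ∀ s t : Set (Pt F), (ψ '' s ∩ ψ '' t).Nonempty ↔ (s ∩ t).Nonempty := fun s t => by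
    rw [← Set.image_inter hinj, Set.image_nonempty]
  rintro _ ⟨S, hS, rfl⟩ hSD _ ⟨t, ht, rfl⟩ _ ⟨t', ht', rfl⟩ h1 h2 _ ⟨m', hm', rfl⟩ h3
  rw [hmeet] at h1 h2 h3 ⊢
  exact h S hS (fun e => hSD (e ▸ rfl)) t ht t' ht' h1 h2 m' hm' h3

theorem mem_lineThrough_semilinear_iff {ψ : Pt F → Pt F} {σ : F ≃+* F}
    {φ : (Fin 4 → F) ≃+ (Fin 4 → F)} (hφ : ∀ (r : F) (v : Fin 4 → F), φ (r • v) = σ r • φ v)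
    (hψ : ∀ (v : Fin 4 → F) (hv : v ≠ 0) (hv' : (φ v : Fin 4 → F) ≠ 0),
      ψ (Projectivization.mk F v hv) = Projectivization.mk F (φ v) hv') (A B P : Pt F) :
    ψ P ∈ lineThrough F (ψ A) (ψ B) ↔ P ∈ lineThrough F A B := by
  have hne : ∀ v : Fin 4 → F, v ≠ 0 → φ v ≠ 0 := fun v hv => (map_ne_zero_iff φ φ.injective).2 hv
  rw [← A.mk_rep, ← B.mk_rep, ← P.mk_rep, hψ _ _ (hne _ A.rep_nonzero),
    hψ _ _ (hne _ B.rep_nonzero), hψ _ _ (hne _ P.rep_nonzero), mem_lineThrough_mk,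
    mem_lineThrough_mk]
  constructor
  · rintro ⟨x, y, h⟩
    refine ⟨σ.symm x, σ.symm y, φ.injective ?_⟩
    simpa [hφ] using h
  · rintro ⟨x, y, h⟩
    exact ⟨σ x, σ y, by rw [← h, map_add, hφ, hφ]⟩

theorem injective_of_mem_lineThrough_iff {ψ : Pt F → Pt F}
    (h : ∀ A B P, ψ P ∈ lineThrough F (ψ A) (ψ B) ↔ P ∈ lineThrough F A B) :
    Function.Injective ψ := by
  intro A B hAB
  have hself : ∀ P Q : Pt F, P ∈ lineThrough F Q Q ↔ P = Q := fun P Q => by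
    rw [← P.mk_rep, ← Q.mk_rep, mem_lineThrough_mk, Projectivization.mk_eq_mk_iff']
    constructor
    · rintro ⟨x, y, hxy⟩
      exact ⟨x + y, by rw [add_smul, hxy]⟩
    · rintro ⟨x, hx⟩
      exact ⟨x, 0, by rw [hx, zero_smul, add_zero]⟩
  rw [← hself, ← h, hself, hAB]

theorem image_Dspread_and_image_rU1 [Fintype F] (hc : IsPowConj q c) (hq3 : 3 ≤ q)
    (hF : Fintype.card F = q ^ 2) {G G' : Finset (F × F × F)}
    (hG : ∀ t ∈ G, IsAdmissible c t) (hG' : ∀ t ∈ G', IsAdmissible c t) (hGne : G'.Nonempty)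
    {ψ : Pt F → Pt F}
    (hline : ∀ A B P, ψ P ∈ lineThrough F (ψ A) (ψ B) ↔ P ∈ lineThrough F A B)
    (hmap : (fun S : Set (Set (Pt F)) => (fun m : Set (Pt F) => ψ '' m) '' S) '' ParP q F 1 G
      = ParP q F 1 G') :
    (fun m : Set (Pt F) => ψ '' m) '' Dspread q F 1 = Dspread q F 1 ∧
    ψ '' (rU1 F ∩ SigmaSet q F 1) = rU1 F ∩ SigmaSet q F 1 := by
  have hinj := injective_of_mem_lineThrough_iff hline
  have hne := hc.exists_ne hq3 hF
  have hD : (fun m : Set (Pt F) => ψ '' m) '' Dspread q F 1 = Dspread q F 1 := by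
    by_contra hD
    have hmem : (fun m : Set (Pt F) => ψ '' m) '' Dspread q F 1 ∈ ParP q F 1 G' := by
      rw [← hmap]
      exact ⟨_, Or.inr rfl, rfl⟩
    obtain ⟨α, x, b, y, hx, hy, hα0, hα1, he⟩ :=
      exists_switchedSpread_of_mem_ParP hc (by omega) hne hG' hmem hD
    apply not_hasReguli_switchedSpread hc hq3 hF hα0 hα1 (indep_triangular (b := b) hx hy)
    rw [← he]
    exact (hasReguli_Dspread hc).image hline
  refine ⟨hD, ?_⟩
  rw [rU1_inter_SigmaSet hc]
  apply eq_ray_of_meetsCompatibly hc hq3 hF hG' hGne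
  · rw [← hD]
    exact ⟨_, (mem_Dspread hc).2 ⟨(1, 0), by simp, rfl⟩, rfl⟩
  · have := (meetsCompatibly_ray hc (by omega) hne hG).image hinj
    rwa [hmap, hD] at this

end Collineations

/-- Any collineation of `PG(3, q²)` stabilizing `Σ_η` and mapping `Π_G` to `Π_{G'}`
stabilizes both the Desarguesian spread `D_η` and the line `r_{U₁} ∩ Σ_η`. -/
theorem statement19 (q : ℕ) (hq : IsPrimePow q) (hq3 : 3 ≤ q) (F : Type) [Field F] [Fintype F]
    (hF : Fintype.card F = q ^ 2) (I : Set F) (hI : IsIndexSet q F I)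
    (η : F) (hηU : η ^ (q + 1) = 1)
    (G G' : Finset (F × F × F))
    (hG : IsGoodSet q F I G) (hG' : IsGoodSet q F I G')
    (ψ : Pt F → Pt F)
    (hψ : ∃ (σ : F ≃+* F) (φ : (Fin 4 → F) ≃+ (Fin 4 → F)),
      (∀ (c : F) (v : Fin 4 → F), φ (c • v) = σ c • φ v) ∧
      ∀ (v : Fin 4 → F) (hv : v ≠ 0) (hv' : (φ v : Fin 4 → F) ≠ 0),
        ψ (Projectivization.mk F v hv) = Projectivization.mk F (φ v) hv')
    (hfix : ψ '' SigmaSet q F η = SigmaSet q F η)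
    (hmap : (fun S : Set (Set (Pt F)) => (fun m : Set (Pt F) => ψ '' m) '' S) '' ParP q F η G
      = ParP q F η G') :
    (fun m : Set (Pt F) => ψ '' m) '' Dspread q F η = Dspread q F η ∧
    ψ '' (rU1 F ∩ SigmaSet q F η) = rU1 F ∩ SigmaSet q F η := by
  obtain ⟨c, hc⟩ := exists_isPowConj hq hF
  obtain ⟨σ, φ, hφ, hψ⟩ := hψ
  have hS : SigmaSet q F η = SigmaSet q F 1 :=
    SigmaSet_eq_of_norm_one hc (hc.exists_ne hq3 hF) (by rw [← hc.pow_eq, ← pow_succ', hηU])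
  rw [ParP_eq_of_norm_one hS (tau_eq_tau_one hηU), ParP_eq_of_norm_one hS (tau_eq_tau_one hηU)]
    at hmap
  rw [Dspread_eq_of_norm_one hS, hS]
  refine image_Dspread_and_image_rU1 hc hq3 hF (hG.isAdmissible hc hI) (hG'.isAdmissible hc hI)
    ?_ (mem_lineThrough_semilinear_iff hφ hψ) hmap
  rw [← Finset.card_pos, hG'.1]
  omega
end
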